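/- For every positive integer n and every integer s with 9 ≤ s ≤ 88, the polynomial g₁(x) = g₁(x,n,s) is irreducible over ℚ. -/

import Mathlib

open Polynomial Finset

/-- g₁(x,n,s) = n!·∑_{j=0}^{n} C(n+s−j, n−j)·x^j/j!, as a polynomial over ℚ. -/
noncomputable def g1 (n s : ℕ) : ℚ[X] :=
  (n.factorial : ℚ[X]) *
    ∑ j ∈ Finset.range (n + 1),
      Polynomial.C (((n + s - j).choose (n - j) : ℚ) / (j.factorial : ℚ)) * Polynomial.X ^ j

section LastMinimizer

variable {p : ℕ} [hp : Fact p.Prime]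

/-- `J` is the last index minimizing `B * v_p (coeff j) + A * j` over the nonzero coefficients. -/
def IsLastMin (p A B : ℕ) (f : ℤ[X]) (J : ℕ) : Prop :=
  f.coeff J ≠ 0 ∧
    (∀ j, f.coeff j ≠ 0 →
      B * padicValInt p (f.coeff J) + A * J ≤ B * padicValInt p (f.coeff j) + A * j) ∧
    ∀ j, J < j → f.coeff j ≠ 0 →
      B * padicValInt p (f.coeff J) + A * J < B * padicValInt p (f.coeff j) + A * j

theorem exists_isLastMin (p A B : ℕ) {f : ℤ[X]} (hf : f ≠ 0) : ∃ J, IsLastMin p A B f J := by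
  set W : ℕ → ℕ := fun j => B * padicValInt p (f.coeff j) + A * j with hW
  obtain ⟨j₀, hj₀, hmin⟩ := f.support.exists_min_image W (by simpa using hf)
  obtain ⟨J, hJ, hmax⟩ := (f.support.filter fun j => W j = W j₀).exists_max_image id
    ⟨j₀, by simp [mem_support_iff.mp hj₀]⟩
  rw [mem_filter] at hJ
  refine ⟨J, mem_support_iff.mp hJ.1, fun j hj => ?_, fun j hlt hj => ?_⟩
  · change W J ≤ W j
    rw [hJ.2]; exact hmin j (mem_support_iff.mpr hj)
  · change W J < W j
    rw [hJ.2]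
    refine lt_of_le_of_ne (hmin j (mem_support_iff.mpr hj)) fun h => ?_
    have := hmax j (mem_filter.mpr ⟨mem_support_iff.mpr hj, h.symm⟩)
    simp only [id] at this
    omega

theorem exists_padicValInt_le_of_sum_ne_zero {ι : Type*} (S : Finset ι) (z : ι → ℤ)
    (h : ∑ i ∈ S, z i ≠ 0) :
    ∃ i ∈ S, z i ≠ 0 ∧ padicValInt p (z i) ≤ padicValInt p (∑ i ∈ S, z i) := by
  by_contra! hc
  have hd : (p : ℤ) ^ (padicValInt p (∑ i ∈ S, z i) + 1) ∣ ∑ i ∈ S, z i := by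
    refine Finset.dvd_sum fun i hi => ?_
    by_cases hz : z i = 0
    · simp [hz]
    · exact (padicValInt_dvd_iff _ _).mpr (Or.inr (hc i hi hz))
  rcases (padicValInt_dvd_iff _ _).mp hd with h0 | h0
  · exact h h0
  · omega

theorem IsLastMin.mul {A B : ℕ} {f h : ℤ[X]} {a b : ℕ} (ha : IsLastMin p A B f a)
    (hb : IsLastMin p A B h b) : IsLastMin p A B (f * h) (a + b) := by
  obtain ⟨ha0, hal, has⟩ := ha
  obtain ⟨hb0, hbl, hbs⟩ := hb
  have hab0 : f.coeff a * h.coeff b ≠ 0 := mul_ne_zero ha0 hb0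
  have hvab := padicValInt.mul (p := p) ha0 hb0
  have hstrict : ∀ x y : ℕ, f.coeff x * h.coeff y ≠ 0 → (a < x ∨ b < y) →
      B * padicValInt p (f.coeff a * h.coeff b) + A * (a + b) <
        B * padicValInt p (f.coeff x * h.coeff y) + A * (x + y) := by
    intro x y hxy hor
    have hx := left_ne_zero_of_mul hxy
    have hy := right_ne_zero_of_mul hxy
    rw [hvab, padicValInt.mul hx hy]
    have h1 := hal x hx
    have h2 := hbl y hy
    rcases hor with h3 | h3
    · have := has x h3 hx
      nlinarith
    · have := hbs y h3 hy
      nlinarith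
  have hle : ∀ x y : ℕ, f.coeff x * h.coeff y ≠ 0 →
      B * padicValInt p (f.coeff a * h.coeff b) + A * (a + b) ≤
        B * padicValInt p (f.coeff x * h.coeff y) + A * (x + y) := by
    intro x y hxy
    have hx := left_ne_zero_of_mul hxy
    have hy := right_ne_zero_of_mul hxy
    rw [hvab, padicValInt.mul hx hy]
    have h1 := hal x hx
    have h2 := hbl y hy
    nlinarith
  have hkey : (f * h).coeff (a + b) ≠ 0 ∧
      padicValInt p ((f * h).coeff (a + b)) = padicValInt p (f.coeff a * h.coeff b) := by
    set t := f.coeff a * h.coeff b with ht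
    set r := ∑ x ∈ (antidiagonal (a + b)).erase (a, b), f.coeff x.1 * h.coeff x.2 with hr
    have hsum : (f * h).coeff (a + b) = t + r := by
      rw [coeff_mul, ← Finset.add_sum_erase _ _ (HasAntidiagonal.mem_antidiagonal.mpr rfl : (a, b) ∈ _)]
    have hrd : (p : ℤ) ^ (padicValInt p t + 1) ∣ r := by
      refine Finset.dvd_sum fun x hx => ?_
      rw [mem_erase, HasAntidiagonal.mem_antidiagonal] at hx
      by_cases hz : f.coeff x.1 * h.coeff x.2 = 0
      · simp [hz]
      · refine (padicValInt_dvd_iff _ _).mpr (Or.inr ?_)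
        have hor : a < x.1 ∨ b < x.2 := by
          by_contra! hc
          exact hx.1 (Prod.ext (by dsimp only; omega) (by dsimp only; omega))
        have := hstrict _ _ hz hor
        rw [hx.2] at this
        exact Nat.lt_of_mul_lt_mul_left (a := B) (by omega)
    have hnd : ¬ (p : ℤ) ^ (padicValInt p t + 1) ∣ t := by
      rw [padicValInt_dvd_iff]
      push Not
      exact ⟨hab0, by omega⟩
    have hnd' : ¬ (p : ℤ) ^ (padicValInt p t + 1) ∣ t + r := by
      rwa [dvd_add_left hrd]
    have hd' : (p : ℤ) ^ (padicValInt p t) ∣ t + r :=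
      dvd_add (padicValInt_dvd _) ((pow_dvd_pow _ (Nat.le_succ _)).trans hrd)
    rw [hsum]
    rw [padicValInt_dvd_iff] at hnd' hd'
    push Not at hnd'
    refine ⟨hnd'.1, ?_⟩
    rcases hd' with h0 | h0
    · exact absurd h0 hnd'.1
    · omega
  refine ⟨hkey.1, fun j hj => ?_, fun j hlt hj => ?_⟩
  · rw [hkey.2]
    rw [coeff_mul] at hj ⊢
    obtain ⟨x, hx, hz, hv⟩ := exists_padicValInt_le_of_sum_ne_zero (p := p) _ _ hj
    have := hle _ _ hz
    rw [HasAntidiagonal.mem_antidiagonal.mp hx] at this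
    exact this.trans (Nat.add_le_add_right (Nat.mul_le_mul_left _ hv) _)
  · rw [hkey.2]
    rw [coeff_mul] at hj ⊢
    obtain ⟨x, hx, hz, hv⟩ := exists_padicValInt_le_of_sum_ne_zero (p := p) _ _ hj
    rw [HasAntidiagonal.mem_antidiagonal] at hx
    have := hstrict _ _ hz (by omega)
    rw [hx] at this
    exact this.trans_le (Nat.add_le_add_right (Nat.mul_le_mul_left _ hv) _)

theorem exists_slope_of_mul {f h G : ℤ[X]} {n k : ℕ} (hG : f * h = G) (hG0 : G ≠ 0)
    (hfk : f.natDegree = k) (hGn : G.natDegree = n) {A₁ B₁ i₁ A₀ B₀ i₀ : ℕ}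
    (hA₀ : 0 < A₀) (hi₁ : i₁ ≤ n) (hi₀ : i₀ ≤ n)
    (hne : ∀ j ≤ n, G.coeff j ≠ 0)
    (h₁ : ∀ j, i₁ < j → j ≤ n → B₁ * padicValInt p (G.coeff i₁) + A₁ * i₁ <
      B₁ * padicValInt p (G.coeff j) + A₁ * j)
    (h₀ : ∀ j < i₀, B₀ * padicValInt p (G.coeff i₀) + A₀ * i₀ ≤
      B₀ * padicValInt p (G.coeff j) + A₀ * j)
    (hlen : n + i₁ < i₀ + k) :
    ∃ d D : ℕ, 1 ≤ d ∧ d ≤ k ∧ A₀ * d ≤ B₀ * D ∧ B₁ * D < A₁ * d := by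
  have hf0 : f ≠ 0 := by rintro rfl; simp at hG; exact hG0 hG.symm
  have hh0 : h ≠ 0 := by rintro rfl; simp at hG; exact hG0 hG.symm
  have hdeg : f.natDegree + h.natDegree = n := by
    rw [← natDegree_mul hf0 hh0, hG, hGn]
  obtain ⟨a, ha⟩ := exists_isLastMin p A₁ B₁ hf0
  obtain ⟨a', ha'⟩ := exists_isLastMin p A₁ B₁ hh0
  obtain ⟨b, hb⟩ := exists_isLastMin p A₀ B₀ hf0
  obtain ⟨b', hb'⟩ := exists_isLastMin p A₀ B₀ hh0
  have haa := ha.mul ha'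
  have hbb := hb.mul hb'
  rw [hG] at haa hbb
  have hle : ∀ {g : ℤ[X]} {j : ℕ}, g.coeff j ≠ 0 → j ≤ g.natDegree :=
    fun hg => le_natDegree_of_ne_zero hg
  have h1 : a + a' ≤ i₁ := by
    by_contra! hc
    have e1 := h₁ _ hc (hGn ▸ hle haa.1)
    have e2 := haa.2.1 i₁ (hne _ hi₁)
    omega
  have h2 : i₀ ≤ b + b' := by
    by_contra! hc
    have e1 := h₀ _ hc
    have e2 := hbb.2.2 i₀ hc (hne _ hi₀)
    omega
  have h3 : b' ≤ h.natDegree := hle hb'.1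
  have h4 : b ≤ f.natDegree := hle hb.1
  have hab : a < b := by omega
  have e1 := ha.2.2 b hab hb.1
  have e0 := hb.2.1 a ha.1
  set va := padicValInt p (f.coeff a)
  set vb := padicValInt p (f.coeff b)
  obtain ⟨d, rfl⟩ := Nat.exists_eq_add_of_lt hab
  have hv : vb ≤ va := by
    by_contra! hc
    have : B₀ * va ≤ B₀ * vb := Nat.mul_le_mul_left _ hc.le
    nlinarith
  obtain ⟨D, hD⟩ := Nat.exists_eq_add_of_le hv
  refine ⟨d + 1, D, by omega, by omega, ?_, ?_⟩
  · rw [hD] at e0; nlinarith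
  · rw [hD] at e1; nlinarith

end LastMinimizer

section Coefficients

/-- The coefficient of `X ^ j` in `g1 n s`, as a natural number. -/
def gCoeff (n s j : ℕ) : ℕ := n.descFactorial (n - j) * (n + s - j).choose s

/-- `g1 n s` with integer coefficients. -/
noncomputable def gInt (n s : ℕ) : ℤ[X] :=
  ∑ j ∈ range (n + 1), C (gCoeff n s j : ℤ) * X ^ j

theorem gInt_coeff (n s j : ℕ) :
    (gInt n s).coeff j = if j ≤ n then (gCoeff n s j : ℤ) else 0 := by
  simp [gInt, coeff_X_pow]

theorem gCoeff_mul_factorial {n j : ℕ} (s : ℕ) (hj : j ≤ n) :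
    gCoeff n s j * j.factorial = n.factorial * (n - j + s).choose s := by
  have h := Nat.factorial_mul_descFactorial (Nat.sub_le n j)
  rw [Nat.sub_sub_self hj] at h
  rw [gCoeff, ← h, Nat.sub_add_comm hj]; ring

theorem gCoeff_pos {n j : ℕ} (s : ℕ) (hj : j ≤ n) : 0 < gCoeff n s j := by
  refine pos_of_mul_pos_left (b := j.factorial) ?_ (Nat.zero_le _)
  rw [gCoeff_mul_factorial s hj]
  exact Nat.mul_pos n.factorial_pos (Nat.choose_pos (by omega))

theorem gCoeff_self (n s : ℕ) : gCoeff n s n = 1 := by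
  simp [gCoeff]

theorem gInt_natDegree (n s : ℕ) : (gInt n s).natDegree = n := by
  refine natDegree_eq_of_le_of_coeff_ne_zero ?_ ?_
  · rw [natDegree_le_iff_coeff_eq_zero]
    intro j hj
    rw [gInt_coeff, if_neg (by omega)]
  · rw [gInt_coeff, if_pos le_rfl, gCoeff_self]; simp

theorem gInt_monic (n s : ℕ) : (gInt n s).Monic := by
  rw [Monic, leadingCoeff, gInt_natDegree, gInt_coeff, if_pos le_rfl, gCoeff_self]; simp

theorem gInt_map (n s : ℕ) : (gInt n s).map (algebraMap ℤ ℚ) = g1 n s := by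
  ext j
  rw [coeff_map, gInt_coeff, g1, ← C_eq_natCast, coeff_C_mul, finsetSum_coeff]
  simp only [coeff_C_mul, coeff_X_pow, mul_ite, mul_one, mul_zero, sum_ite_eq, mem_range]
  by_cases hj : j ≤ n
  · rw [if_pos hj, if_pos (by omega)]
    have h := gCoeff_mul_factorial s hj
    have h' : ((gCoeff n s j : ℕ) : ℚ) * j.factorial = n.factorial * (n - j + s).choose s := by
      exact_mod_cast h
    have hc : (n + s - j).choose (n - j) = (n - j + s).choose s := by
      rw [Nat.sub_add_comm hj]
      exact Nat.choose_symm_of_eq_add rfl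
    rw [hc]
    have : (j.factorial : ℚ) ≠ 0 := by exact_mod_cast j.factorial_ne_zero
    field_simp
    simpa using h'
  · rw [if_neg hj, if_neg (by omega)]; simp

/-- `gInt n s` has a monic factor of degree `k`. -/
def HasFactor (n s k : ℕ) : Prop :=
  ∃ f h : ℤ[X], f.Monic ∧ h.Monic ∧ f * h = gInt n s ∧ f.natDegree = k

theorem irreducible_of_not_hasFactor {n s : ℕ} (hn : 1 ≤ n)
    (h : ∀ k, 1 ≤ k → 2 * k ≤ n → ¬ HasFactor n s k) : Irreducible (g1 n s) := by
  rw [← gInt_map, ← (gInt_monic n s).irreducible_iff_irreducible_map_fraction_map,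
    (gInt_monic n s).irreducible_iff_natDegree']
  refine ⟨fun h1 => ?_, fun f g hf hg hfg hmem => ?_⟩
  · have := gInt_natDegree n s
    rw [h1, natDegree_one] at this
    omega
  · rw [gInt_natDegree, mem_Ioc] at hmem
    exact h g.natDegree hmem.1 (by omega) ⟨g, f, hg, hf, by rw [mul_comm, hfg], rfl⟩

theorem padicValNat_gCoeff {p : ℕ} [hp : Fact p.Prime] {n j : ℕ} (s : ℕ) (hj : j ≤ n) :
    padicValNat p (gCoeff n s j) + padicValNat p j.factorial =
      padicValNat p n.factorial + padicValNat p ((n - j + s).choose s) := by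
  rw [← padicValNat.mul (gCoeff_pos s hj).ne' j.factorial_ne_zero, gCoeff_mul_factorial s hj,
    padicValNat.mul n.factorial_ne_zero (Nat.choose_pos (by omega)).ne']

theorem HasFactor.exists_slope {n s k : ℕ} (hF : HasFactor n s k) (p : ℕ) [hp : Fact p.Prime]
    {A₁ B₁ i₁ A₀ B₀ i₀ : ℕ} (hA₀ : 0 < A₀) (hi₁ : i₁ ≤ n) (hi₀ : i₀ ≤ n)
    (h₁ : ∀ j, i₁ < j → j ≤ n → B₁ * padicValNat p (gCoeff n s i₁) + A₁ * i₁ <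
      B₁ * padicValNat p (gCoeff n s j) + A₁ * j)
    (h₀ : ∀ j < i₀, B₀ * padicValNat p (gCoeff n s i₀) + A₀ * i₀ ≤
      B₀ * padicValNat p (gCoeff n s j) + A₀ * j)
    (hlen : n + i₁ < i₀ + k) :
    ∃ d D : ℕ, 1 ≤ d ∧ d ≤ k ∧ A₀ * d ≤ B₀ * D ∧ B₁ * D < A₁ * d := by
  obtain ⟨f, h, -, -, hfh, hk⟩ := hF
  have hc : ∀ j ≤ n, (gInt n s).coeff j = (gCoeff n s j : ℤ) := fun j hj => by
    rw [gInt_coeff, if_pos hj]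
  refine exists_slope_of_mul (p := p) hfh (gInt_monic n s).ne_zero hk (gInt_natDegree n s)
    hA₀ hi₁ hi₀ (fun j hj => ?_) (fun j hj hjn => ?_) (fun j hj => ?_) hlen
  · rw [hc j hj]; exact_mod_cast (gCoeff_pos s hj).ne'
  · rw [hc j hjn, hc i₁ hi₁, padicValInt.of_nat, padicValInt.of_nat]
    exact h₁ j hj hjn
  · rw [hc j (by omega), hc i₀ hi₀, padicValInt.of_nat, padicValInt.of_nat]
    exact h₀ j hj

end Coefficients

section Slope

variable {n s k p : ℕ} [hp : Fact p.Prime]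

theorem not_hasFactor_of_slope (hkn : k ≤ n) (hdvd : ∀ j ≤ n - k, p ∣ gCoeff n s j)
    (hslope : ∀ j, 0 < j → j ≤ n →
      k * (padicValNat p ((n + s).choose s) + padicValNat p j.factorial) <
        k * padicValNat p ((n - j + s).choose s) + j) : ¬ HasFactor n s k := by
  intro hF
  have hex : ∃ j, ¬ p ∣ gCoeff n s j := ⟨n, by
    rw [gCoeff_self]; exact hp.out.one_lt.ne' ∘ Nat.dvd_one.mp⟩
  classical
  have hlt : n - k < Nat.find hex := by
    by_contra! hc
    exact Nat.find_spec hex (hdvd _ hc)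
  have hle : Nat.find hex ≤ n :=
    Nat.find_min' hex (by rw [gCoeff_self]; exact hp.out.one_lt.ne' ∘ Nat.dvd_one.mp)
  obtain ⟨d, D, hd, hdk, h0, h1⟩ := hF.exists_slope p (A₁ := 1) (B₁ := k) (i₁ := 0) (A₀ := 1)
    (B₀ := n + 1) (i₀ := Nat.find hex) one_pos (Nat.zero_le _) hle
    (fun j hj hjn => by
      have e1 := padicValNat_gCoeff (p := p) s (Nat.zero_le n)
      have e2 := padicValNat_gCoeff (p := p) s hjn
      simp only [Nat.factorial_zero, padicValNat_one_right, Nat.sub_zero, add_zero] at e1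
      have := hslope j hj hjn
      rw [e1]
      have e3 := congrArg (k * ·) e2
      simp only [mul_add] at e3 this ⊢
      omega)
    (fun j hj => by
      have hz : padicValNat p (gCoeff n s (Nat.find hex)) = 0 :=
        padicValNat.eq_zero_of_not_dvd (Nat.find_spec hex)
      have hj1 : 1 ≤ padicValNat p (gCoeff n s j) :=
        one_le_padicValNat_of_dvd (gCoeff_pos s (by omega)).ne'
          (by simpa using Nat.find_min hex hj)
      rw [hz]
      nlinarith)
    (by omega)
  rcases Nat.eq_zero_or_pos D with rfl | hD
  · omega
  · nlinarith

theorem dvd_gCoeff_of_dvd_sub {i j m : ℕ} (h : m ∣ n - i) (hij : i < n - j) :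
    m ∣ gCoeff n s j := by
  rw [gCoeff, Nat.descFactorial_eq_prod_range]
  exact (h.trans (Finset.dvd_prod_of_mem _ (mem_range.mpr hij))).mul_right _

theorem dvd_gCoeff_of_dvd_add {t j m : ℕ} (h : m ∣ s + t) (ht : 1 ≤ t) (htj : t ≤ n - j) :
    m ∣ gCoeff n s j := by
  have : gCoeff n s j = n.choose (n - j) * (n - j + s).descFactorial (n - j) := by
    rw [gCoeff, Nat.descFactorial_eq_factorial_mul_choose, Nat.descFactorial_eq_factorial_mul_choose,
      Nat.sub_add_comm (by omega), ← Nat.choose_symm_of_eq_add (add_comm (n - j) s)]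
    ring
  rw [this, Nat.descFactorial_eq_prod_range]
  refine (h.trans ?_).mul_left _
  have e : n - j + s - (n - j - t) = s + t := by omega
  rw [← e]
  exact Finset.dvd_prod_of_mem (fun i => n - j + s - i) (mem_range.mpr (by omega))

theorem not_hasFactor_of_slope_of_lt {J : ℕ} (hkp : k < p) (hkn : k ≤ n)
    (hdvd : ∀ j ≤ n - k, p ∣ gCoeff n s j)
    (hslope : ∀ j, 0 < j → j < J →
      k * (padicValNat p ((n + s).choose s) + padicValNat p j.factorial) <
        k * padicValNat p ((n - j + s).choose s) + j)
    (hJ : k * ((p - 1) * padicValNat p ((n + s).choose s)) + k * (J - 1) < (p - 1) * J) :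
    ¬ HasFactor n s k := by
  refine not_hasFactor_of_slope hkn hdvd fun j hj hjn => ?_
  by_cases hjJ : j < J
  · exact hslope j hj hjJ
  push Not at hjJ
  have hv := sub_one_mul_padicValNat_factorial_lt_of_ne_zero p hj.ne'
  set V := padicValNat p ((n + s).choose s)
  have hp1 := hp.out.one_lt
  obtain ⟨q, rfl⟩ : ∃ q, p = q + 1 := ⟨p - 1, by omega⟩
  simp only [Nat.add_sub_cancel] at *
  refine lt_of_lt_of_le ?_ (Nat.le_add_left _ _)
  obtain ⟨x, rfl⟩ := Nat.exists_eq_add_of_le hjJ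
  have hq : 0 < q := by omega
  refine Nat.lt_of_mul_lt_mul_left (a := q) ?_
  have h1 : q * padicValNat (q + 1) (J + x).factorial + 1 ≤ J + x := hv
  rcases Nat.eq_zero_or_pos J with rfl | hJ0
  · simp at hJ
  obtain ⟨J, rfl⟩ : ∃ J', J = J' + 1 := ⟨J - 1, by omega⟩
  simp only [Nat.add_sub_cancel] at *
  nlinarith

theorem choose_mul_descFactorial_eq {j : ℕ} (hj : j ≤ n) :
    (n + s).choose s * n.descFactorial j = (n - j + s).choose s * (n + s).descFactorial j := by
  have h1 := Nat.add_choose_mul_factorial_mul_factorial n s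
  have h2 := Nat.add_choose_mul_factorial_mul_factorial (n - j) s
  have h3 := Nat.factorial_mul_descFactorial hj
  have h4 := Nat.factorial_mul_descFactorial (show j ≤ n + s by omega)
  rw [show n + s - j = n - j + s by omega] at h4
  have hpos : 0 < (n - j).factorial * s.factorial :=
    Nat.mul_pos (Nat.factorial_pos _) (Nat.factorial_pos _)
  refine Nat.eq_of_mul_eq_mul_right hpos ?_
  calc _ = (n + s).choose s * ((n - j).factorial * n.descFactorial j) * s.factorial := by ring
    _ = (n + s).choose s * n.factorial * s.factorial := by rw [h3]
    _ = (n - j + s).factorial * (n + s).descFactorial j := by rw [h1, h4]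
    _ = (n - j + s).choose s * (n - j).factorial * s.factorial * (n + s).descFactorial j := by
        rw [h2]
    _ = _ := by ring

theorem not_hasFactor_of_residue {i : ℕ} (hkp : k < p) (hkn : k ≤ n) (hi : i < k)
    (hdvd : p ∣ n - i) (hc : i + s % p < p)
    (hJ : k * ((p - 1) * padicValNat p ((n + s).choose s)) + k * (i + s % p) <
      (p - 1) * (i + s % p + 1)) :
    ¬ HasFactor n s k := by
  refine not_hasFactor_of_slope_of_lt (J := i + s % p + 1) hkp hkn
    (fun j hj => dvd_gCoeff_of_dvd_sub hdvd (by omega)) (fun j hj hjJ => ?_) (by simpa using hJ)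
  by_cases hjn : n < j
  · have hn : n = 0 ∨ n < p := by omega
    have : n - i = 0 := Nat.eq_zero_of_dvd_of_lt hdvd (by omega)
    omega
  have hz : padicValNat p j.factorial = 0 :=
    padicValNat.eq_zero_of_not_dvd fun h => by
      have := (hp.out.dvd_factorial).mp h
      omega
  have hnd : ¬ p ∣ (n + s).descFactorial j := by
    rw [Nat.descFactorial_eq_prod_range, hp.out.prime.dvd_finsetProd_iff]
    rintro ⟨t, ht, htd⟩
    rw [mem_range] at ht
    obtain ⟨a, ha⟩ := hdvd
    have hs := Nat.div_add_mod s p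
    have e : n + s - t = p * (a + s / p) + (i + s % p - t) := by rw [mul_add]; omega
    rw [e, Nat.dvd_add_right (dvd_mul_right _ _)] at htd
    have := Nat.le_of_dvd (by omega) htd
    omega
  have hid := congrArg (padicValNat p) (choose_mul_descFactorial_eq (s := s) (not_lt.mp hjn))
  rw [padicValNat.mul (Nat.choose_pos (by omega)).ne'
      (Nat.descFactorial_pos.mpr (not_lt.mp hjn)).ne',
    padicValNat.mul (Nat.choose_pos (by omega)).ne'
      (Nat.descFactorial_pos.mpr (by omega)).ne', padicValNat.eq_zero_of_not_dvd hnd] at hid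
  rw [hz, add_zero]
  have : k * padicValNat p ((n + s).choose s) ≤ k * padicValNat p ((n - j + s).choose s) :=
    Nat.mul_le_mul_left _ (by omega)
  omega

end Slope

section DigitSum

/-- Sum of the base `p` digits. -/
def dsum (p z : ℕ) : ℕ := (p.digits z).sum

theorem dsum_zero (p : ℕ) : dsum p 0 = 0 := by simp [dsum]

theorem dsum_eq {p : ℕ} (hp : 1 < p) (z : ℕ) : dsum p z = z % p + dsum p (z / p) := by
  rcases Nat.eq_zero_or_pos z with rfl | hz
  · simp [dsum]
  · rw [dsum, Nat.digits_def' hp hz, List.sum_cons, dsum]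

theorem dsum_of_lt {p z : ℕ} (hp : 1 < p) (hz : z < p) : dsum p z = z := by
  rw [dsum_eq hp, Nat.mod_eq_of_lt hz, Nat.div_eq_of_lt hz, dsum_zero, add_zero]

theorem dsum_add_pow_mul {p : ℕ} (hp : 1 < p) (e : ℕ) :
    ∀ {a : ℕ} (b : ℕ), a < p ^ e → dsum p (a + p ^ e * b) = dsum p a + dsum p b := by
  induction e with
  | zero => intro a b ha; obtain rfl : a = 0 := by simpa using ha
            simp [dsum_zero]
  | succ e ih =>
    intro a b ha
    have hp0 : 0 < p := by omega
    rw [dsum_eq hp (a + _), dsum_eq hp a]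
    have h1 : a + p ^ (e + 1) * b = a + p * (p ^ e * b) := by ring
    rw [h1, Nat.add_mul_mod_self_left, Nat.add_mul_div_left _ _ hp0, ih b, add_assoc]
    rw [Nat.div_lt_iff_lt_mul hp0, ← pow_succ]; exact ha

theorem dsum_pos {p z : ℕ} (hp : 1 < p) (hz : 0 < z) : 0 < dsum p z := by
  induction z using Nat.strong_induction_on with
  | _ z ih =>
    rw [dsum_eq hp]
    by_cases h : z % p = 0
    · have hd : p ≤ z := Nat.le_of_dvd hz (Nat.dvd_of_mod_eq_zero h)
      have := ih (z / p) (Nat.div_lt_self hz hp) (Nat.div_pos hd (by omega))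
      omega
    · omega

theorem sub_one_mul_padicValNat_factorial_add_dsum (p : ℕ) [hp : Fact p.Prime] (z : ℕ) :
    (p - 1) * padicValNat p z.factorial + dsum p z = z := by
  rw [sub_one_mul_padicValNat_factorial, dsum]
  exact Nat.sub_add_cancel (Nat.digit_sum_le p z)

theorem dsum_add_le {p a b : ℕ} [hp : Fact p.Prime] (hab : a ≤ b) :
    dsum p b + a ≤ dsum p a + b := by
  have h1 := sub_one_mul_padicValNat_factorial_add_dsum p a
  have h2 := sub_one_mul_padicValNat_factorial_add_dsum p b
  have h3 : padicValNat p a.factorial ≤ padicValNat p b.factorial :=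
    (padicValNat_dvd_iff_le b.factorial_ne_zero).mp
      (pow_padicValNat_dvd.trans (Nat.factorial_dvd_factorial hab))
  have := Nat.mul_le_mul_left (p - 1) h3
  omega

theorem padicValNat_choose_le_of_carry {p s y z : ℕ} [hp : Fact p.Prime]
    (h : ∀ l, 1 ≤ l → p ^ l ≤ s % p ^ l + y % p ^ l → p ^ l ≤ s % p ^ l + z % p ^ l) :
    padicValNat p ((y + s).choose s) ≤ padicValNat p ((z + s).choose s) := by
  set b := max (Nat.log p (y + s)) (Nat.log p (z + s)) + 1
  rw [padicValNat_choose' (b := b) (by omega), padicValNat_choose' (b := b) (by omega)]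
  refine card_le_card fun l hl => ?_
  rw [mem_filter, mem_Ico] at hl ⊢
  exact ⟨hl.1, h l hl.1.1 hl.2⟩

theorem padicValNat_choose_mod_le {p : ℕ} [hp : Fact p.Prime] (s z r : ℕ) :
    padicValNat p ((z % p ^ r + s).choose s) ≤ padicValNat p ((z + s).choose s) := by
  refine padicValNat_choose_le_of_carry fun l _ hl => hl.trans (Nat.add_le_add_left ?_ _)
  rcases le_total l r with h | h
  · rw [Nat.mod_mod_of_dvd _ (pow_dvd_pow p h)]
  · rw [← Nat.mod_mod_of_dvd z (pow_dvd_pow p h)]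
    exact (Nat.mod_le _ _).trans (Nat.mod_le _ _)

end DigitSum

section Coleman

variable {n s k p e i : ℕ} [hp : Fact p.Prime]

theorem exists_dsum_lt {lo z : ℕ} (hlo : i < lo) (hloe : lo < p ^ e)
    (hz : (z + lo) % p ^ e = i) :
    ∃ j ≤ i, dsum p j < dsum p lo ∧
      padicValNat p ((i - j + s).choose s) ≤ padicValNat p ((z + s).choose s) := by
  have hp1 := hp.out.one_lt
  have hx : z % p ^ e + lo = p ^ e + i := by
    have h1 := Nat.mod_lt z (show 0 < p ^ e by omega)
    rw [Nat.add_mod, Nat.mod_eq_of_lt hloe] at hz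
    generalize z % p ^ e = x at h1 hz ⊢
    rcases lt_or_ge (x + lo) (p ^ e) with h | h
    · rw [Nat.mod_eq_of_lt h] at hz; omega
    · rw [Nat.mod_eq_sub_mod h, Nat.mod_eq_of_lt (by omega)] at hz; omega
  have hr : ∃ r < e, z % p ^ r ≤ i ∧ i < z % p ^ (r + 1) := by
    by_contra! hc
    have : ∀ r ≤ e, z % p ^ r ≤ i := by
      intro r
      induction r with
      | zero => intro _; simp [Nat.mod_one]
      | succ r ih => intro hr; exact hc r hr (ih (by omega))
    have := this e le_rfl
    omega
  obtain ⟨r, hre, hr1, hr2⟩ := hr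
  refine ⟨i - z % p ^ r, Nat.sub_le _ _, ?_, ?_⟩
  swap
  · rw [Nat.sub_sub_self hr1]; exact padicValNat_choose_mod_le s z r
  set q := p ^ r with hq
  have hq0 : 0 < q := Nat.pow_pos (by omega)
  set j := i - z % q with hj
  set X := z / q % p with hX
  have hzX : z % p ^ (r + 1) = z % q + q * X := by
    rw [pow_succ, Nat.mod_mul]
  have hXp : X < p := Nat.mod_lt _ (by omega)
  have hjX : j < q * X := by omega
  have hb : j / q < X := by
    rw [Nat.div_lt_iff_lt_mul hq0, mul_comm]; exact hjX
  have hj2 := Nat.div_add_mod j q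
  have hjm := Nat.mod_lt j hq0
  have hlo2 : lo % p ^ (r + 1) = j % q + q * (p - X + j / q) := by
    have h1 : lo % p ^ (r + 1) = (j % q + q * (p - X + j / q)) % p ^ (r + 1) := by
      have h2 : z % p ^ (r + 1) + lo ≡ z % p ^ (r + 1) + (j % q + q * (p - X + j / q))
          [MOD p ^ (r + 1)] := by
        have h3 : z % p ^ (r + 1) + (j % q + q * (p - X + j / q)) = i + p ^ (r + 1) := by
          rw [hzX, mul_add, Nat.mul_sub, pow_succ, ← hq]
          have : q * X ≤ q * p := Nat.mul_le_mul_left _ hXp.le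
          omega
        rw [h3]
        have h4 : z % p ^ (r + 1) + lo ≡ z % p ^ e + lo [MOD p ^ (r + 1)] := by
          refine Nat.ModEq.add_right _ ?_
          rw [Nat.ModEq, Nat.mod_mod, Nat.mod_mod_of_dvd _ (pow_dvd_pow p hre)]
        refine h4.trans ?_
        rw [hx]
        obtain ⟨c, hc⟩ := pow_dvd_pow p hre
        rw [hc, Nat.ModEq]
        simp [add_comm]
      exact Nat.ModEq.add_left_cancel' _ h2
    rw [h1, Nat.mod_eq_of_lt]
    rw [pow_succ, ← hq]
    have : q * (p - X + j / q) + q ≤ q * p := by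
      rw [← Nat.mul_succ]; exact Nat.mul_le_mul_left _ (by omega)
    omega
  have e1 : dsum p j = dsum p (j % q) + j / q := by
    conv_lhs => rw [← hj2, add_comm]
    rw [dsum_add_pow_mul hp1 r _ hjm, dsum_of_lt hp1 (z := j / q) (by omega)]
  have e2 : dsum p (lo % p ^ (r + 1)) = dsum p (j % q) + (p - X + j / q) := by
    rw [hlo2, dsum_add_pow_mul hp1 r _ hjm, dsum_of_lt hp1 (z := p - X + j / q) (by omega)]
  have e3 : dsum p lo = dsum p (lo % p ^ (r + 1)) + dsum p (lo / p ^ (r + 1)) := by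
    conv_lhs => rw [← Nat.mod_add_div lo (p ^ (r + 1))]
    exact dsum_add_pow_mul hp1 _ _ (Nat.mod_lt _ (Nat.pow_pos (by omega)))
  omega

/-- If `p ^ e ∣ n - i`, then `g1 n s` has no factor of degree `k` in the range `i < k < p ^ e`,
provided that the digit sum function on `[0, i]` attains its minimum last at `i₁` close to `i`. -/
theorem not_hasFactor_of_last_min {i₁ : ℕ} (hdvd : p ^ e ∣ n - i) (hik : i < k) (hin : i ≤ n)
    (hke : k < p ^ e) (hi₁ : i₁ ≤ i) (hsi : s + (i - i₁) < p ^ e)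
    (hmin : ∀ j ≤ i, dsum p i₁ + (p - 1) * padicValNat p ((i - i₁ + s).choose s) ≤
      dsum p j + (p - 1) * padicValNat p ((i - j + s).choose s))
    (hlast : ∀ j ≤ i, i₁ < j → dsum p i₁ + (p - 1) * padicValNat p ((i - i₁ + s).choose s) <
      dsum p j + (p - 1) * padicValNat p ((i - j + s).choose s)) :
    ¬ HasFactor n s k := by
  intro hF
  have hp1 := hp.out.one_lt
  obtain ⟨M, hM⟩ := hdvd
  set q := p ^ e with hq
  have hn : n = i + q * M := by omega
  have hq0 : 0 < q := by omega
  set h := dsum p i₁ + (p - 1) * padicValNat p ((i - i₁ + s).choose s) with hh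
  have hV : ∀ j ≤ n, (p - 1) * padicValNat p (gCoeff n s j) + j =
      (p - 1) * padicValNat p n.factorial +
        (dsum p j + (p - 1) * padicValNat p ((n - j + s).choose s)) := by
    intro j hj
    have h1 := congrArg ((p - 1) * ·) (padicValNat_gCoeff (p := p) s hj)
    have h2 := sub_one_mul_padicValNat_factorial_add_dsum p j
    simp only [mul_add] at h1
    omega
  have hlow : ∀ j ≤ n, j / q ≤ M ∧
      dsum p (j / q) + h ≤ dsum p j + (p - 1) * padicValNat p ((n - j + s).choose s) ∧
      (i₁ < j % q →
        dsum p (j / q) + h < dsum p j + (p - 1) * padicValNat p ((n - j + s).choose s)) := by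
    intro j hj
    have hjq := Nat.mod_add_div j q
    have hlt := Nat.mod_lt j hq0
    have hS : dsum p j = dsum p (j % q) + dsum p (j / q) := by
      conv_lhs => rw [← hjq]
      exact dsum_add_pow_mul hp1 _ _ hlt
    have hhi : j / q ≤ M := by
      by_contra! hc
      have : q * (M + 1) ≤ q * (j / q) := Nat.mul_le_mul_left _ hc
      rw [mul_add] at this
      omega
    refine ⟨hhi, ?_⟩
    obtain ⟨x, hx⟩ := Nat.exists_eq_add_of_le hhi
    rcases le_or_gt (j % q) i with hli | hli
    · have hz : (n - j) % q = i - j % q := by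
        have : n - j = (i - j % q) + q * x := by
          rw [hx, mul_add] at hn; omega
        rw [this, Nat.add_mul_mod_self_left, Nat.mod_eq_of_lt (by omega)]
      have h1 := padicValNat_choose_mod_le (p := p) s (n - j) e
      rw [← hq, hz] at h1
      have h2 := Nat.mul_le_mul_left (p - 1) h1
      have h3 := hmin _ hli
      refine ⟨by omega, fun hlt' => ?_⟩
      have := hlast _ hli hlt'
      omega
    · have hz : (n - j + j % q) % q = i := by
        have : n - j + j % q = i + q * x := by
          rw [hx, mul_add] at hn; omega
        rw [this, Nat.add_mul_mod_self_left, Nat.mod_eq_of_lt (by omega)]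
      obtain ⟨j', hj', h1, h2⟩ := exists_dsum_lt (s := s) hli hlt hz
      have h3 := hmin _ hj'
      have h4 := Nat.mul_le_mul_left (p - 1) h2
      omega
  have hHi₁ : dsum p i₁ + (p - 1) * padicValNat p ((n - i₁ + s).choose s) ≤ h := by
    refine Nat.add_le_add_left (Nat.mul_le_mul_left _ ?_) _
    refine padicValNat_choose_le_of_carry fun l _ hl => ?_
    have hni : n - i₁ = (i - i₁) + q * M := by omega
    rw [hni] at hl
    rcases le_or_gt l e with hle | hle
    · obtain ⟨c, hc⟩ := pow_dvd_pow p hle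
      rwa [hq, hc, mul_assoc, Nat.add_mul_mod_self_left] at hl
    · exfalso
      have hpl : p ^ l = q * p ^ (l - e) := by rw [hq, ← pow_add]; congr 1; omega
      have hs1 := Nat.mod_le s (p ^ l)
      have hxm : ((i - i₁) + q * M) % p ^ l = (i - i₁) + q * (M % p ^ (l - e)) := by
        rw [hpl, Nat.mod_mul, Nat.add_mul_mod_self_left, Nat.add_mul_div_left _ _ hq0,
          Nat.mod_eq_of_lt (show i - i₁ < q by omega), Nat.div_eq_of_lt (show i - i₁ < q by omega),
          zero_add]
      have hml : M % p ^ (l - e) + 1 ≤ p ^ (l - e) := Nat.mod_lt _ (Nat.pow_pos (by omega))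
      have := Nat.mul_le_mul_left q hml
      rw [mul_add, ← hpl] at this
      omega
  have hi₀ : i₁ + q * M ≤ n := by omega
  have hHi₀ : dsum p (i₁ + q * M) + (p - 1) * padicValNat p ((n - (i₁ + q * M) + s).choose s) =
      dsum p M + h := by
    rw [dsum_add_pow_mul hp1 _ _ (show i₁ < p ^ e by omega),
      show n - (i₁ + q * M) = i - i₁ by omega]
    omega
  obtain ⟨d, D, hd, hdk, h0, h1⟩ := hF.exists_slope p (A₁ := 1) (B₁ := p - 1) (i₁ := i₁)
    (A₀ := q - 1) (B₀ := q * (p - 1)) (i₀ := i₁ + q * M) (by omega) (by omega) hi₀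
    (fun j hj hjn => by
      have e1 := hV j hjn
      have e2 := hV i₁ (by omega)
      obtain ⟨-, e3, e4⟩ := hlow j hjn
      have hjq := Nat.mod_add_div j q
      have : h < dsum p j + (p - 1) * padicValNat p ((n - j + s).choose s) := by
        rcases lt_or_ge i₁ (j % q) with hc | hc
        · have := e4 hc; omega
        · have : 0 < j / q := by
            rcases Nat.eq_zero_or_pos (j / q) with h0 | h0
            · rw [h0] at hjq; omega
            · exact h0
          have := dsum_pos hp1 this
          omega
      omega)
    (fun j hj => by
      have hjn : j ≤ n := by omega
      have e1 := hV j hjn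
      have e2 := hV _ hi₀
      rw [hHi₀] at e2
      obtain ⟨e5, e3, e4⟩ := hlow j hjn
      have hjq := Nat.mod_add_div j q
      have hlt := Nat.mod_lt j hq0
      have e6 := dsum_add_le (p := p) e5
      set H := dsum p j + (p - 1) * padicValNat p ((n - j + s).choose s)
      set K := (p - 1) * padicValNat p n.factorial
      have hmain : q * (dsum p M + h) + j ≤ q * H + (i₁ + q * M) := by
        rcases lt_or_ge i₁ (j % q) with hc | hc
        · have e7 := e4 hc
          have : q * (dsum p M + h + j / q + 1) ≤ q * (H + M) := Nat.mul_le_mul_left _ (by omega)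
          simp only [mul_add] at this ⊢
          omega
        · have : q * (dsum p M + h + j / q) ≤ q * (H + M) := Nat.mul_le_mul_left _ (by omega)
          simp only [mul_add] at this ⊢
          omega
      obtain ⟨q', hq'⟩ : ∃ q', q = q' + 1 := ⟨q - 1, by omega⟩
      have f1 := congrArg (q * ·) e1
      have f2 := congrArg (q * ·) e2
      simp only [mul_add] at f1 f2 hmain
      rw [mul_assoc q (p - 1), mul_assoc q (p - 1), Nat.sub_mul q 1 (i₁ + q * M), Nat.sub_mul q 1 j]
      have g1 : j ≤ q * j := Nat.le_mul_of_pos_left _ hq0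
      have g2 : i₁ + q * M ≤ q * i₁ + q * (q * M) :=
        Nat.add_le_add (Nat.le_mul_of_pos_left _ hq0) (Nat.le_mul_of_pos_left _ hq0)
      rw [one_mul, one_mul, mul_add]
      omega)
    (by omega)
  have h2 : q * ((p - 1) * D) + q ≤ q * d := by
    rw [← Nat.mul_succ]; exact Nat.mul_le_mul_left _ (by omega)
  rw [Nat.sub_mul, mul_assoc] at h0
  omega

theorem not_hasFactor_of_pow_dvd (hdvd : p ^ e ∣ n - i) (hik : i < k) (hin : i ≤ n)
    (hke : k < p ^ e) (hsi : s + i < p ^ e) : ¬ HasFactor n s k := by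
  set W : ℕ → ℕ := fun j => dsum p j + (p - 1) * padicValNat p ((i - j + s).choose s) with hW
  obtain ⟨j₀, hj₀, hmin⟩ := (range (i + 1)).exists_min_image W ⟨0, by simp⟩
  obtain ⟨i₁, hi₁, hmax⟩ := ((range (i + 1)).filter fun j => W j = W j₀).exists_max_image id
    ⟨j₀, by rw [mem_filter]; exact ⟨hj₀, rfl⟩⟩
  rw [mem_filter, mem_range] at hi₁
  refine not_hasFactor_of_last_min (i₁ := i₁) hdvd hik hin hke (by omega) (by omega)
    (fun j hj => ?_) (fun j hj hlt => ?_)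
  · change W i₁ ≤ W j
    rw [hi₁.2]; exact hmin j (mem_range.mpr (by omega))
  · change W i₁ < W j
    rw [hi₁.2]
    refine lt_of_le_of_ne (hmin j (mem_range.mpr (by omega))) fun h => ?_
    have := hmax j (mem_filter.mpr ⟨mem_range.mpr (by omega), h.symm⟩)
    simp only [id] at this
    omega

theorem not_hasFactor_of_dvd (hdvd : p ∣ n - i) (hik : i < k) (hin : i ≤ n)
    (hkp : k < p) (hsp : s < p) : ¬ HasFactor n s k := by
  have hp1 := hp.out.one_lt
  rcases lt_or_ge (s + i) p with hc | hc
  · exact not_hasFactor_of_pow_dvd (p := p) (e := 1) (by simpa using hdvd) hik hin (by simpa)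
      (by simpa)
  have hz : padicValNat p ((i - (i + s - p + 1) + s).choose s) = 0 := by
    rw [show i - (i + s - p + 1) + s = p - 1 by omega]
    refine padicValNat.eq_zero_of_not_dvd fun h => ?_
    have h2 : (p - 1).choose s ∣ (p - 1).factorial :=
      ⟨s.factorial * (p - 1 - s).factorial, by
        rw [← Nat.choose_mul_factorial_mul_factorial (show s ≤ p - 1 by omega), mul_assoc]⟩
    have := (hp.out.dvd_factorial).mp (h.trans h2)
    omega
  have hlt : ∀ j ≤ i, i + s - p + 1 ≤ j ∨
      p - 1 ≤ (p - 1) * padicValNat p ((i - j + s).choose s) := by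
    intro j hj
    rcases le_or_gt (i + s - p + 1) j with h | h
    · exact Or.inl h
    · right
      refine Nat.le_mul_of_pos_right _ (one_le_padicValNat_of_dvd (Nat.choose_pos (by omega)).ne' ?_)
      have h1 := Nat.add_choose_mul_factorial_mul_factorial (i - j) s
      have h2 : p ∣ (i - j + s).factorial := (hp.out.dvd_factorial).mpr (by omega)
      rw [← h1, hp.out.dvd_mul, hp.out.dvd_mul, hp.out.dvd_factorial, hp.out.dvd_factorial] at h2
      rcases h2 with (h2 | h2) | h2
      · exact h2
      · omega
      · omega
  refine not_hasFactor_of_last_min (p := p) (e := 1) (i₁ := i + s - p + 1) (by simpa using hdvd)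
    hik hin (by simpa) (by omega) (by rw [pow_one]; omega) (fun j hj => ?_) (fun j hj hj2 => ?_)
  all_goals
    rw [hz, dsum_of_lt hp1 (z := i + s - p + 1) (by omega), dsum_of_lt hp1 (z := j) (by omega)]
    rcases hlt j hj with h | h <;> omega

end Coleman

section Consequences

theorem HasFactor.pow_le {n s k p e i : ℕ} (hF : HasFactor n s k) (hkn : k ≤ n) (hp : p.Prime)
    (hik : i < k) (hdvd : p ^ e ∣ n - i) : p ^ e ≤ max k (s + i) := by
  have := Fact.mk hp
  by_contra! hc
  rw [max_lt_iff] at hc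
  exact not_hasFactor_of_pow_dvd hdvd hik (by omega) hc.1 hc.2 hF

theorem HasFactor.prime_le {n s k p i : ℕ} (hF : HasFactor n s k) (hkn : k ≤ n) (hp : p.Prime)
    (hik : i < k) (hdvd : p ∣ n - i) : p ≤ max k s := by
  have := Fact.mk hp
  by_contra! hc
  rw [max_lt_iff] at hc
  exact not_hasFactor_of_dvd hdvd hik (by omega) hc.1 hc.2 hF

open MeasureTheory in
theorem sum_choose_mul_factorial_pos {n s : ℕ} (hn : Even n) (x : ℝ) :
    0 < ∑ j ∈ range (n + 1), x ^ j * n.choose j * (n - j + s).factorial := by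
  have hterm : ∀ m : ℕ, IntegrableOn (fun t : ℝ => Real.exp (-t) * t ^ m) (Set.Ioi 0) ∧
      ∫ t in Set.Ioi (0 : ℝ), Real.exp (-t) * t ^ m = m.factorial := by
    intro m
    have h1 := Real.GammaIntegral_convergent (s := m + 1) (by positivity)
    have h2 := Real.Gamma_eq_integral (s := m + 1) (by positivity)
    rw [Real.Gamma_nat_eq_factorial] at h2
    simp only [add_sub_cancel_right, Real.rpow_natCast] at h1 h2
    exact ⟨h1, h2.symm⟩
  have hexp : ∀ t : ℝ, Real.exp (-t) * t ^ s * (x + t) ^ n =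
      ∑ j ∈ range (n + 1), x ^ j * n.choose j * (Real.exp (-t) * t ^ (n - j + s)) := by
    intro t
    rw [add_pow, Finset.mul_sum]
    refine Finset.sum_congr rfl fun j _ => ?_
    rw [pow_add]; ring
  have hint : ∫ t in Set.Ioi (0 : ℝ), Real.exp (-t) * t ^ s * (x + t) ^ n =
      ∑ j ∈ range (n + 1), x ^ j * n.choose j * (n - j + s).factorial := by
    simp_rw [hexp]
    rw [integral_finsetSum _ fun j _ => (hterm _).1.const_mul _]
    refine Finset.sum_congr rfl fun j _ => ?_
    rw [integral_const_mul, (hterm _).2]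
  have hI : IntegrableOn (fun t : ℝ => Real.exp (-t) * t ^ s * (x + t) ^ n) (Set.Ioi 0) := by
    simp_rw [hexp]
    exact integrable_finsetSum _ fun j _ => (hterm _).1.const_mul _
  rw [← hint, setIntegral_pos_iff_support_of_nonneg_ae _ hI]
  · refine lt_of_lt_of_le ?_ (measure_mono (s := Set.Ioi |x|) fun t ht => ?_)
    · simp
    · rw [Set.mem_Ioi] at ht
      have h0 : 0 < t := (abs_nonneg x).trans_lt ht
      have h1 : 0 < x + t := by linarith [neg_abs_le x]
      refine ⟨?_, h0⟩
      rw [Function.mem_support]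
      positivity
  · filter_upwards [ae_restrict_mem measurableSet_Ioi] with t ht
    rw [Set.mem_Ioi] at ht
    have := hn.pow_nonneg (x + t)
    simp only [Pi.zero_apply]
    positivity

theorem gInt_eval_ne_zero_of_even {n : ℕ} (s : ℕ) (hn : Even n) (x : ℤ) :
    (gInt n s).eval x ≠ 0 := by
  intro h
  have h1 := sum_choose_mul_factorial_pos (s := s) hn (x : ℝ)
  have h2 : (∑ j ∈ range (n + 1), (x : ℝ) ^ j * n.choose j * (n - j + s).factorial) =
      s.factorial * ((gInt n s).eval x : ℤ) := by
    rw [gInt, eval_finsetSum]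
    push_cast
    rw [Finset.mul_sum]
    refine Finset.sum_congr rfl fun j hj => ?_
    have hj : j ≤ n := by rw [mem_range] at hj; omega
    simp only [eval_mul, eval_C, eval_pow, eval_X]
    push_cast
    have h3 : n.choose j * (n - j + s).factorial = s.factorial * gCoeff n s j := by
      refine Nat.eq_of_mul_eq_mul_right j.factorial_pos ?_
      rw [mul_assoc s.factorial, gCoeff_mul_factorial s hj,
        ← Nat.add_choose_mul_factorial_mul_factorial (n - j) s,
        ← Nat.choose_mul_factorial_mul_factorial hj]
      ring
    have h4 : (n.choose j : ℝ) * (n - j + s).factorial = s.factorial * gCoeff n s j := by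
      exact_mod_cast h3
    rw [mul_assoc, h4]; ring
  rw [h2, h] at h1
  simp at h1

theorem HasFactor.odd {n s : ℕ} (hF : HasFactor n s 1) : Odd n := by
  rw [← Nat.not_even_iff_odd]
  intro hn
  obtain ⟨f, h, hf, -, hfh, hdeg⟩ := hF
  refine gInt_eval_ne_zero_of_even s hn (-f.coeff 0) ?_
  have := hf.eq_X_add_C hdeg
  rw [← hfh, eval_mul, this]
  simp

end Consequences

section Sylvester

theorem pow_padicValNat_choose_le {n k p B : ℕ} (hp : p.Prime) (hkn : k ≤ n) (hB : 0 < B)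
    (h : ∀ i < k, ∀ l, p ^ l ∣ n - i → p ^ l ≤ B) :
    p ^ (n.choose k).factorization p ≤ B := by
  refine Nat.pow_le_of_le_log hB.ne' ?_
  rw [Nat.factorization_choose hp hkn (Nat.lt_succ_self _)]
  refine (card_le_card (t := Icc 1 (Nat.log p B)) fun l hl => ?_).trans (by simp)
  rw [mem_filter, mem_Ico] at hl
  rw [mem_Icc]
  refine ⟨hl.1.1, Nat.le_log_of_pow_le hp.one_lt
    (h (n % p ^ l) ?_ l (Nat.dvd_sub_mod n))⟩
  have h0 : 0 < p ^ l := Nat.pow_pos hp.pos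
  have h1 := Nat.mod_lt (n - k) h0
  have h2 := Nat.mod_le k (p ^ l)
  have h3 : n % p ^ l = (k % p ^ l + (n - k) % p ^ l) % p ^ l := by
    rw [← Nat.add_mod, Nat.add_sub_cancel' hkn]
  rw [h3, Nat.mod_eq_sub_mod hl.2]
  exact (Nat.mod_le _ _).trans_lt (by omega)

theorem choose_le_of_factorization {n k m B : ℕ} (hkn : k ≤ n) (hB : 0 < B)
    (hm : ∀ p, p.Prime → m < p → (n.choose k).factorization p = 0)
    (h : ∀ p, p.Prime → p ^ (n.choose k).factorization p ≤ B) :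
    n.choose k ≤ B ^ Nat.sqrt B * 4 ^ m := by
  have hne : n.choose k ≠ 0 := (Nat.choose_pos hkn).ne'
  set S := {p ∈ range (m + 1) | p.Prime} with hS
  set f : ℕ → ℕ := fun p => p ^ (n.choose k).factorization p with hf
  have hprod : n.choose k = ∏ p ∈ S, f p := by
    conv_lhs => rw [← Nat.prod_factorization_pow_eq_self hne]
    rw [Finsupp.prod]
    refine Finset.prod_subset (fun p hp => ?_) (fun p hp hp' => ?_)
    · have hpr : p.Prime := Nat.prime_of_mem_primeFactors (Nat.support_factorization _ ▸ hp)
      rw [hS, mem_filter, mem_range]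
      refine ⟨?_, hpr⟩
      by_contra! hc
      exact (Finsupp.mem_support_iff.mp hp) (hm p hpr (by omega))
    · rw [Finsupp.notMem_support_iff.mp hp', pow_zero]
  rw [hprod, ← Finset.prod_filter_mul_prod_filter_not S (· ≤ Nat.sqrt B)]
  refine mul_le_mul' ?_ ?_
  · refine (Finset.prod_le_prod' fun p hp => (?_ : f p ≤ B)).trans ?_
    · exact h p (mem_filter.mp (mem_filter.mp hp).1).2
    rw [Finset.prod_const]
    refine Nat.pow_le_pow_right hB ((card_le_card (t := Icc 1 (Nat.sqrt B)) fun p hp => ?_).trans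
      (by simp))
    obtain ⟨h1, h2⟩ := mem_filter.mp hp
    exact mem_Icc.mpr ⟨(mem_filter.mp h1).2.one_lt.le, h2⟩
  · refine le_trans ?_ (primorial_le_four_pow m)
    refine (Finset.prod_le_prod' fun p hp => (?_ : f p ≤ p)).trans ?_
    · obtain ⟨h1, h2⟩ := mem_filter.mp hp
      have hpr := (mem_filter.mp h1).2
      have h3 : B < p ^ 2 := Nat.sqrt_lt'.mp (not_le.mp h2)
      have h4 : (n.choose k).factorization p < 2 :=
        (Nat.pow_lt_pow_iff_right hpr.one_lt).mp ((h p hpr).trans_lt h3)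
      calc f p ≤ p ^ 1 := Nat.pow_le_pow_right hpr.pos (by omega)
        _ = p := pow_one p
    · exact Finset.prod_le_prod_of_subset_of_one_le' (Finset.filter_subset _ _)
        fun p hp _ => (mem_filter.mp hp).2.one_lt.le

theorem cube_mul_pow_sqrt_le {k : ℕ} (hk : 512 ≤ k) :
    k ^ 3 * ((2 * k) ^ Nat.sqrt (2 * k)) ^ 3 ≤ 4 ^ k := by
  have h := Bertrand.real_main_inequality (x := k) (by exact_mod_cast hk)
  have hk0 : (0 : ℝ) < k := by exact_mod_cast (by omega : 0 < k)
  have h1 : (((2 * k) ^ Nat.sqrt (2 * k) : ℕ) : ℝ) ≤ (2 * (k : ℝ)) ^ √(2 * (k : ℝ)) := by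
    push_cast
    rw [← Real.rpow_natCast]
    refine Real.rpow_le_rpow_of_exponent_le ?_ ?_
    · have : (512 : ℝ) ≤ k := by exact_mod_cast hk
      linarith
    · have := Real.nat_sqrt_le_real_sqrt (a := 2 * k)
      push_cast at this
      exact this
  set y := (2 * (k : ℝ)) ^ √(2 * (k : ℝ)) with hy
  set w := (4 : ℝ) ^ ((k : ℝ) / 3) with hw
  have hw0 : 0 < w := Real.rpow_pos_of_pos (by norm_num) _
  have hw2 : (4 : ℝ) ^ (2 * (k : ℝ) / 3) = w ^ 2 := by
    rw [hw, ← Real.rpow_natCast, ← Real.rpow_mul (by norm_num)]; congr 1; push_cast; ring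
  have hw3 : (4 : ℝ) ^ (k : ℝ) = w ^ 3 := by
    rw [hw, ← Real.rpow_natCast, ← Real.rpow_mul (by norm_num)]; congr 1; push_cast; ring
  rw [hw2, hw3] at h
  have h2 : (k : ℝ) * y ≤ w := by
    refine le_of_mul_le_mul_right ?_ (pow_pos hw0 2)
    calc _ ≤ w ^ 3 := h
      _ = _ := by ring
  have h3 : ((k * (2 * k) ^ Nat.sqrt (2 * k) : ℕ) : ℝ) ^ 3 ≤ (4 : ℝ) ^ k := by
    rw [← Real.rpow_natCast 4, hw3]
    refine pow_le_pow_left₀ (by positivity) ?_ 3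
    push_cast at h1 ⊢
    exact (mul_le_mul_of_nonneg_left h1 hk0.le).trans h2
  rw [← mul_pow]
  exact_mod_cast h3

theorem pow_le_mul_choose_three_mul {k : ℕ} (hk : 1 ≤ k) :
    27 ^ k ≤ 4 ^ k * (3 * k * (3 * k).choose k) := by
  induction k, hk using Nat.le_induction with
  | base => decide
  | succ k hk ih =>
    have h1 := Nat.add_one_mul_choose_eq (3 * k + 2) k
    have e1 := Nat.choose_mul_succ_eq (3 * k) k
    have e2 := Nat.choose_mul_succ_eq (3 * k + 1) k
    rw [show 3 * k + 1 - k = 2 * k + 1 by omega] at e1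
    rw [show 3 * k + 1 + 1 - k = 2 * k + 2 by omega] at e2
    simp only [show 3 * k + 1 + 1 = 3 * k + 2 by omega,
      show 3 * k + 2 + 1 = 3 * (k + 1) by omega] at h1 e1 e2
    set a := (3 * k).choose k
    set b := (3 * k + 1).choose k
    set c := (3 * k + 2).choose k
    set d := (3 * (k + 1)).choose (k + 1)
    have hd : d = 3 * c := by
      refine Nat.eq_of_mul_eq_mul_right (show 0 < k + 1 by omega) ?_
      rw [← h1]; ring
    have hc : c * ((2 * k + 2) * (2 * k + 1)) = a * ((3 * k + 1) * (3 * k + 2)) := by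
      calc _ = c * (2 * k + 2) * (2 * k + 1) := by ring
        _ = b * (2 * k + 1) * (3 * k + 2) := by rw [← e2]; ring
        _ = _ := by rw [← e1]; ring
    have hstep : 27 * (3 * k * a) ≤ 4 * (3 * (k + 1) * d) := by
      refine Nat.le_of_mul_le_mul_right ?_ (show 0 < (2 * k + 2) * (2 * k + 1) by positivity)
      rw [hd]
      calc 27 * (3 * k * a) * ((2 * k + 2) * (2 * k + 1))
          = a * (27 * (3 * k) * ((2 * k + 2) * (2 * k + 1))) := by ring
        _ ≤ a * (36 * (k + 1) * ((3 * k + 1) * (3 * k + 2))) :=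
            Nat.mul_le_mul_left _ (by nlinarith [Nat.zero_le (k ^ 3), Nat.zero_le (k ^ 2)])
        _ = 36 * (k + 1) * (c * ((2 * k + 2) * (2 * k + 1))) := by rw [hc]; ring
        _ = _ := by ring
    calc 27 ^ (k + 1) = 27 * 27 ^ k := by ring
      _ ≤ 27 * (4 ^ k * (3 * k * a)) := Nat.mul_le_mul_left _ ih
      _ = 4 ^ k * (27 * (3 * k * a)) := by ring
      _ ≤ 4 ^ k * (4 * (3 * (k + 1) * d)) := Nat.mul_le_mul_left _ hstep
      _ = _ := by ring

theorem lt_cube_choose_three_mul {k : ℕ} (hk : 512 ≤ k) :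
    4 ^ (4 * k) < k ^ 3 * (3 * k).choose k ^ 3 := by
  have h := Nat.pow_le_pow_left (pow_le_mul_choose_three_mul (show 1 ≤ k by omega)) 3
  have h1 : 27 * 16384 ^ k < 19683 ^ k := by
    obtain ⟨m, rfl⟩ := Nat.exists_eq_add_of_le' (show 20 ≤ k by omega)
    have := Nat.pow_le_pow_left (show 16384 ≤ 19683 by norm_num) m
    have h0 : 0 < 19683 ^ m := by positivity
    rw [pow_add, pow_add]
    norm_num
    nlinarith
  set a := (3 * k).choose k
  have e1 : (27 ^ k) ^ 3 = 19683 ^ k := by rw [← pow_mul, mul_comm, pow_mul]; norm_num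
  have e2 : (4 ^ k * (3 * k * a)) ^ 3 = 4 ^ (3 * k) * 27 * (k ^ 3 * a ^ 3) := by
    rw [mul_pow, ← pow_mul, mul_comm k 3]; ring
  rw [e1, e2] at h
  have e3 : 16384 ^ k = 4 ^ (3 * k) * 4 ^ (4 * k) := by
    rw [← pow_add, ← add_mul, pow_mul]; norm_num
  rw [e3] at h1
  have h2 : 4 ^ (3 * k) * 27 * 4 ^ (4 * k) < 4 ^ (3 * k) * 27 * (k ^ 3 * a ^ 3) := by
    refine lt_of_lt_of_le ?_ h
    calc _ = 27 * (4 ^ (3 * k) * 4 ^ (4 * k)) := by ring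
      _ < _ := h1
  exact Nat.lt_of_mul_lt_mul_left h2

theorem lt_cube_choose {n k : ℕ} (hk : 512 ≤ k) (h2 : 2 * k ≤ n) (h3 : n ≤ 3 * k) :
    4 ^ (n + k) < k ^ 3 * n.choose k ^ 3 := by
  have hrec : ∀ m, k ≤ m →
      ((m + 1).choose k * (m + 1 - k)) ^ 3 = (m.choose k * (m + 1)) ^ 3 := fun m _ => by
    rw [Nat.choose_mul_succ_eq m k]
  rcases le_or_gt (4 * (n - k) ^ 3) (n ^ 3) with hc | hc
  · have hup : ∀ m, 2 * k ≤ m → m ≤ n →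
        (2 * k).choose k ^ 3 * 4 ^ (m - 2 * k) ≤ m.choose k ^ 3 := by
      intro m hm
      induction m, hm using Nat.le_induction with
      | base => intro _; simp
      | succ m hm ih =>
        intro hmn
        have ih := ih (by omega)
        have hr := hrec m (by omega)
        rw [mul_pow, mul_pow] at hr
        have hx : 4 * (m + 1 - k) ^ 3 ≤ (m + 1) ^ 3 := by
          obtain ⟨y, rfl⟩ := Nat.exists_eq_add_of_le hmn
          have hcross : (m + 1 + y) * (m + 1 - k) ≤ (m + 1) * (m + 1 + y - k) := by
            obtain ⟨u, hu⟩ := Nat.exists_eq_add_of_le (show k ≤ m + 1 by omega)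
            rw [hu, show k + u - k = u by omega, show k + u + y - k = u + y by omega]
            nlinarith
          have h4 := Nat.pow_le_pow_left hcross 3
          rw [mul_pow, mul_pow] at h4
          have hpos : 0 < (m + 1 + y - k) ^ 3 := Nat.pow_pos (by omega)
          refine Nat.le_of_mul_le_mul_right ?_ hpos
          calc _ = 4 * (m + 1 + y - k) ^ 3 * (m + 1 - k) ^ 3 := by ring
            _ ≤ (m + 1 + y) ^ 3 * (m + 1 - k) ^ 3 := Nat.mul_le_mul_right _ hc
            _ ≤ _ := h4
        have hpos : 0 < (m + 1 - k) ^ 3 := Nat.pow_pos (by omega)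
        refine Nat.le_of_mul_le_mul_right ?_ hpos
        rw [hr, show m + 1 - 2 * k = m - 2 * k + 1 by omega, pow_succ 4]
        calc _ = ((2 * k).choose k ^ 3 * 4 ^ (m - 2 * k)) * (4 * (m + 1 - k) ^ 3) := by ring
          _ ≤ _ := Nat.mul_le_mul ih hx
    have h4 := Nat.pow_lt_pow_left (Nat.four_pow_lt_mul_centralBinom k (by omega))
      (show 3 ≠ 0 by norm_num)
    rw [Nat.centralBinom_eq_two_mul_choose, mul_pow] at h4
    have h5 := hup n h2 le_rfl
    have e : 4 ^ (n + k) = (4 ^ k) ^ 3 * 4 ^ (n - 2 * k) := by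
      rw [← pow_mul, ← pow_add]; congr 1; omega
    rw [e]
    calc _ < k ^ 3 * (2 * k).choose k ^ 3 * 4 ^ (n - 2 * k) :=
          Nat.mul_lt_mul_of_pos_right h4 (by positivity)
      _ = k ^ 3 * ((2 * k).choose k ^ 3 * 4 ^ (n - 2 * k)) := by ring
      _ ≤ _ := Nat.mul_le_mul_left _ h5
  · have hdown : ∀ m, n ≤ m → m.choose k ^ 3 ≤ n.choose k ^ 3 * 4 ^ (m - n) := by
      intro m hm
      induction m, hm using Nat.le_induction with
      | base => simp
      | succ m hm ih =>
        have hr := hrec m (by omega)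
        rw [mul_pow, mul_pow] at hr
        have hx : (m + 1) ^ 3 ≤ 4 * (m + 1 - k) ^ 3 := by
          obtain ⟨y, rfl⟩ := Nat.exists_eq_add_of_le hm
          have hcross : (n + y + 1) * (n - k) ≤ n * (n + y + 1 - k) := by
            obtain ⟨u, rfl⟩ := Nat.exists_eq_add_of_le (show k ≤ n by omega)
            rw [show k + u - k = u by omega, show k + u + y + 1 - k = u + y + 1 by omega]
            nlinarith
          have h4 := Nat.pow_le_pow_left hcross 3
          rw [mul_pow, mul_pow] at h4
          have hpos : 0 < (n - k) ^ 3 := Nat.pow_pos (by omega)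
          refine Nat.le_of_mul_le_mul_right ?_ hpos
          calc _ ≤ n ^ 3 * (n + y + 1 - k) ^ 3 := h4
            _ ≤ 4 * (n - k) ^ 3 * (n + y + 1 - k) ^ 3 := Nat.mul_le_mul_right _ hc.le
            _ = _ := by ring
        have hpos : 0 < (m + 1 - k) ^ 3 := Nat.pow_pos (by omega)
        refine Nat.le_of_mul_le_mul_right ?_ hpos
        rw [hr, show m + 1 - n = m - n + 1 by omega, pow_succ 4]
        calc _ ≤ (n.choose k ^ 3 * 4 ^ (m - n)) * (4 * (m + 1 - k) ^ 3) := Nat.mul_le_mul ih hx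
          _ = _ := by ring
    have h4 := hdown (3 * k) h3
    have h5 := lt_cube_choose_three_mul hk
    have e : 4 ^ (4 * k) = 4 ^ (n + k) * 4 ^ (3 * k - n) := by
      rw [← pow_add]; congr 1; omega
    rw [e] at h5
    refine Nat.lt_of_mul_lt_mul_right (a := 4 ^ (3 * k - n)) (h5.trans_le ?_)
    rw [mul_assoc]
    exact Nat.mul_le_mul_left _ h4

theorem pow_le_pow_mul_choose {n k : ℕ} (hkn : k ≤ n) : n ^ k ≤ k ^ k * n.choose k := by
  refine Nat.le_of_mul_le_mul_right ?_ k.factorial_pos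
  have h : k ^ k * n.choose k * k.factorial = k ^ k * n.descFactorial k := by
    rw [Nat.descFactorial_eq_factorial_mul_choose]; ring
  have hc : ∀ a : ℕ, a ^ k = ∏ _i ∈ range k, a := fun a => by simp
  rw [h, ← Nat.descFactorial_self k, Nat.descFactorial_eq_prod_range,
    Nat.descFactorial_eq_prod_range, hc, hc, ← Finset.prod_mul_distrib, ← Finset.prod_mul_distrib]
  refine Finset.prod_le_prod' fun i hi => ?_
  rw [mem_range] at hi
  obtain ⟨u, rfl⟩ := Nat.exists_eq_add_of_le hi.le
  rw [show i + u - i = u by omega]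
  obtain ⟨v, rfl⟩ := Nat.exists_eq_add_of_le hkn
  rw [show i + u + v - i = u + v by omega]
  nlinarith

end Sylvester

section LargeDegree

theorem two_mul_pow_le {k t : ℕ} (hk : 9 ≤ k) (hk' : k < 512) (ht : t * t ≤ 2 * k) :
    (2 * k) ^ t ≤ 4 ^ k := by
  have h : ∀ k < 512, 9 ≤ k → ∀ t < 32, t * t ≤ 2 * k → (2 * k) ^ t ≤ 4 ^ k := by decide +kernel
  exact h k hk' hk t (by nlinarith) ht

def primeChain : List ℕ :=
  [67, 101, 131, 163, 197, 229, 263, 293, 317, 349, 383, 409, 443, 467, 499, 523, 557, 587,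
    619, 653, 691, 733, 773, 821, 863, 911, 967, 1021, 1069, 1129, 1193, 1259, 1327, 1409,
    1493, 1583, 1669, 1759, 1867, 1979, 2099, 2221, 2357, 2503, 2659, 2819, 2971, 3137,
    3331, 3539, 3739, 3967, 4211, 4463, 4733, 5023, 5333, 5659, 6011, 6379, 6763, 7177,
    7621, 8093, 8597]

theorem primeChain_prime : ∀ p ∈ primeChain, p.Prime := by
  simp only [primeChain, List.forall_mem_cons, List.not_mem_nil, false_imp_iff, implies_true,
    and_true]
  norm_num

theorem primeChain_isChain :
    primeChain.IsChain fun a b => b ≤ a + 34 ∨ b ≤ a + a / 16 := by decide +kernel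

theorem exists_mem_between_of_isChain {R : ℕ → ℕ → Prop} {n : ℕ} :
    ∀ {l : List ℕ} {a : ℕ}, (a :: l).IsChain R → a ≤ n → (∃ b ∈ a :: l, n < b) →
      ∃ b ∈ a :: l, ∃ c, R b c ∧ b ≤ n ∧ n < c
  | [], a, _, ha, hb => by
    obtain ⟨b, hb, hn⟩ := hb
    rw [List.mem_singleton] at hb
    omega
  | c :: l, a, hl, ha, hb => by
    rw [List.isChain_cons_cons] at hl
    by_cases hc : n < c
    · exact ⟨a, List.mem_cons_self, c, hl.1, ha, hc⟩
    · obtain ⟨b, hb, hn⟩ := hb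
      have hb' : ∃ b ∈ c :: l, n < b := by
        rcases List.mem_cons.mp hb with rfl | hb
        · omega
        · exact ⟨b, hb, hn⟩
      obtain ⟨x, hx, h⟩ := exists_mem_between_of_isChain hl.2 (not_lt.mp hc) hb'
      exact ⟨x, List.mem_cons_of_mem _ hx, h⟩

theorem exists_prime_near {n k : ℕ} (hk : 9 ≤ k) (hk' : k < 512) (h2 : 2 * k ≤ n)
    (hn : n ≤ 16 * k) : ∃ p i, p.Prime ∧ k < p ∧ i < k ∧ p ∣ n - i := by
  rcases lt_or_ge k 34 with h | h
  · have key : ∀ k < 34, 9 ≤ k → ∀ n < 16 * k + 1, 2 * k ≤ n →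
        ∃ p ∈ [11, 13, 17, 19, 23, 29, 31, 37, 41, 43], k < p ∧ n % p < k := by decide +kernel
    obtain ⟨p, hp, hkp, hnp⟩ := key k h hk n (by omega) h2
    refine ⟨p, n % p, ?_, hkp, hnp, Nat.dvd_sub_mod n⟩
    revert p
    simp only [List.forall_mem_cons, List.not_mem_nil]
    norm_num
  · obtain ⟨b, hb, c, hbc, hbn, hnc⟩ := exists_mem_between_of_isChain (n := n)
      primeChain_isChain (by omega) ⟨8597, by decide, by omega⟩
    refine ⟨b, n - b, primeChain_prime b hb, by omega, by omega, ?_⟩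
    rw [Nat.sub_sub_self hbn]

/-- A version of Sylvester's theorem: the product `n (n - 1) ⋯ (n - k + 1)` has a prime factor
larger than `k`, or else too large a prime power divides one of its factors. -/
theorem not_hasFactor_of_le {n s k : ℕ} (hk : 9 ≤ k) (hsk : s ≤ k) (h2 : 2 * k ≤ n) :
    ¬ HasFactor n s k := by
  intro hF
  have hkn : k ≤ n := by omega
  have hpow : ∀ p, p.Prime → p ^ (n.choose k).factorization p ≤ 2 * k := fun p hp =>
    pow_padicValNat_choose_le hp hkn (by omega) fun i hi l hl =>
      (hF.pow_le hkn hp hi hl).trans (by rw [max_le_iff]; omega)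
  have hprime : ∀ p i, p.Prime → k < p → i < k → ¬ p ∣ n - i := fun p i hp hkp hi hd => by
    have := hF.prime_le hkn hp hi hd
    rw [le_max_iff] at this
    omega
  have hzero : ∀ p, p.Prime → k < p → (n.choose k).factorization p = 0 := fun p hp hkp => by
    have h1 : p ^ (n.choose k).factorization p ≤ k :=
      pow_padicValNat_choose_le hp hkn (by omega) fun i hi l hl => by
        rcases l with - | l
        · rw [pow_zero]; omega
        · exact absurd ((dvd_pow_self p l.succ_ne_zero).trans hl) (hprime p i hp hkp hi)
    by_contra h0
    have := Nat.le_self_pow h0 p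
    omega
  rcases lt_or_ge k 512 with hk' | hk'
  · have h1 := choose_le_of_factorization hkn (by omega) hzero hpow
    have h3 := two_mul_pow_le hk hk' (Nat.sqrt_le (2 * k))
    have h4 : n ^ k ≤ (16 * k) ^ k := by
      calc n ^ k ≤ k ^ k * n.choose k := pow_le_pow_mul_choose hkn
        _ ≤ k ^ k * (4 ^ k * 4 ^ k) :=
            Nat.mul_le_mul_left _ (h1.trans (Nat.mul_le_mul_right _ h3))
        _ = (16 * k) ^ k := by rw [← mul_pow, ← mul_pow]; congr 1; ring
    have h5 : n ≤ 16 * k := (Nat.pow_le_pow_iff_left (by omega)).mp h4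
    obtain ⟨p, i, hp, hkp, hi, hd⟩ := exists_prime_near hk hk' h2 h5
    exact hprime p i hp hkp hi hd
  · have hmain := cube_mul_pow_sqrt_le hk'
    have hcontra : ∀ m C, C ≤ (2 * k) ^ Nat.sqrt (2 * k) * 4 ^ m →
        k ^ 3 * C ^ 3 ≤ 4 ^ (3 * m + k) := fun m C hC => by
      calc k ^ 3 * C ^ 3 ≤ k ^ 3 * ((2 * k) ^ Nat.sqrt (2 * k) * 4 ^ m) ^ 3 :=
            Nat.mul_le_mul_left _ (Nat.pow_le_pow_left hC 3)
        _ = k ^ 3 * ((2 * k) ^ Nat.sqrt (2 * k)) ^ 3 * 4 ^ (3 * m) := by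
            rw [mul_pow, ← pow_mul 4, mul_comm m 3]; ring
        _ ≤ 4 ^ k * 4 ^ (3 * m) := Nat.mul_le_mul_right _ hmain
        _ = _ := by rw [← pow_add, add_comm]
    rcases lt_or_ge n (3 * k) with h3 | h3
    · have h1 := choose_le_of_factorization (m := n / 3) hkn (by omega) (fun p hp hmp => by
        rcases lt_or_ge k p with hkp | hkp
        · exact hzero p hp hkp
        · exact Nat.factorization_choose_of_lt_three_mul (by omega) hkp (by omega) (by omega)) hpow
      have h4 := (lt_cube_choose hk' h2 h3.le).trans_le (hcontra _ _ h1)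
      have := (Nat.pow_lt_pow_iff_right (show 1 < 4 by norm_num)).mp h4
      omega
    · have h1 := choose_le_of_factorization hkn (by omega) hzero hpow
      have h4 := (lt_cube_choose_three_mul hk').trans_le
        (hcontra _ _ ((Nat.choose_le_choose k h3).trans h1))
      have := (Nat.pow_lt_pow_iff_right (show 1 < 4 by norm_num)).mp h4
      omega

end LargeDegree

noncomputable section Kernel

/-! The functions below are evaluated by the kernel, so they are written with raw recursors. -/

def andB (b c : Bool) : Bool := Bool.rec false c b

def orB (b c : Bool) : Bool := Bool.rec c true b

def anyB {α : Type} (f : α → Bool) (l : List α) : Bool :=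
  List.rec false (fun a _ ih => orB (f a) ih) l

def allB {α : Type} (f : α → Bool) (l : List α) : Bool :=
  List.rec true (fun a _ ih => andB (f a) ih) l

/-- Evaluates `n` to a literal before passing it to `f`. -/
def withNat (n : ℕ) (f : ℕ → Bool) : Bool := Nat.rec (f 0) (fun m _ => f (Nat.succ m)) n

/-- Evaluates `l` to a list of literals before passing it to `f`. -/
def withNats (l : List ℕ) : (List ℕ → Bool) → Bool :=
  List.rec (fun f => f []) (fun a _ ih f => withNat a fun b => ih fun t => f (b :: t)) l

def dvdB (a b : ℕ) : Bool := Nat.beq (Nat.mod b a) 0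

def smallPrimes : List ℕ :=
  [89, 83, 79, 73, 71, 67, 61, 59, 53, 47, 43, 41, 37, 31, 29, 23, 19, 17, 13, 11, 7, 5, 3, 2]

/-- The least `V` such that `(p - 1) * (r + 1) ≤ k * r + k * (p - 1) * V`. -/
def minVal (k p r : ℕ) : ℕ := ((p - 1) * (r + 1) - k * r + (k * (p - 1) - 1)) / (k * (p - 1))

def residueTest (n s k p : ℕ) : Bool :=
  withNat (n % p) fun i => andB (Nat.ble (i + 1) k) <| andB (Nat.ble (k + 1) p) <|
    orB (Nat.ble (s + 1) p) <| withNat (s % p) fun r => andB (Nat.ble (i + r + 1) p) <|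
      withNat (p ^ (minVal k p (i + r) + 1)) fun q => Nat.ble (n % q + s + 1) q

/-- The number of carries when `n + s + c` is computed in base `p`. -/
def carries (p t : ℕ) : ℕ → ℕ → ℕ → ℕ :=
  Nat.rec (fun _ _ _ => 0) (fun _ ih n s c =>
    Bool.rec (Bool.rec (ih (n / p) (s / p) 0) (ih (n / p) (s / p) 1 + 1)
      (Nat.ble p (n % p + s % p + c))) 0 (Nat.ble (s + c) 0)) t

/-- The valuation of `m !`. -/
def facVal (p t : ℕ) : ℕ → ℕ :=
  Nat.rec (fun _ => 0) (fun _ ih m => m / p + ih (m / p)) t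

def slopeLoop (n s k p V t : ℕ) : ℕ → Bool :=
  Nat.rec (fun _ => false) (fun _ ih j =>
    orB (Nat.ble (k * ((p - 1) * V) + k * (j - 1) + 1) ((p - 1) * j)) <|
      andB (Nat.ble (k * (V + facVal p 10 j) + 1) (k * carries p 70 (n - j) s 0 + j)) <|
        withNat (j + 1) ih) t

def slopeTest (n s k p : ℕ) : Bool :=
  andB (Nat.ble (k + 1) p) <| andB (orB (Nat.ble (n % p + 1) k) (Nat.ble (p - s % p) k)) <|
    withNat (carries p 70 n s 0) fun V => slopeLoop n s k p V 100 1

def exceptions : List (ℕ × ℕ × ℕ) :=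
  [(1, 3, 15), (1, 3, 26), (1, 3, 53), (1, 3, 80), (2, 8, 13), (2, 6, 14), (2, 9, 19),
    (2, 16, 19), (2, 4, 23), (2, 16, 24), (2, 9, 26), (2, 16, 34), (2, 12, 43), (2, 9, 47),
    (2, 4, 47), (2, 8, 48), (2, 8, 62), (2, 6, 79), (2, 16, 79), (3, 9, 13), (3, 8, 13),
    (3, 16, 19), (3, 18, 33), (3, 9, 47), (3, 6, 47), (3, 16, 62), (4, 16, 62)]

def exceptional (n s k : ℕ) : Bool :=
  anyB (fun x => andB (Nat.beq k x.1) (andB (Nat.beq n x.2.1) (Nat.beq s x.2.2))) exceptions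

def fullTest (l : List ℕ) (n s k : ℕ) : Bool :=
  orB (anyB (residueTest n s k) l) (orB (anyB (slopeTest n s k) smallPrimes) (exceptional n s k))

def windowTest (M n k : ℕ) : Bool := allB (fun i => dvdB (n - i) M) (List.range k)

def leafTest (k s M n p : ℕ) : Bool :=
  Bool.rec true (orB (residueTest n s k p) (orB (Nat.ble (n + 1) (2 * k))
    (fullTest smallPrimes n s k))) (windowTest M n k)

def allowed (k s X lo hi p e : ℕ) : Bool :=
  andB (Nat.ble (p ^ e) (max k (s + hi))) <| orB (Nat.ble p k) <| andB (Nat.ble p s) <|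
    orB (Nat.ble p (hi + s % p)) <|
      Nat.ble ((p ^ (e + minVal k p (lo + s % p)) - (s + k - 1)) ^ k) X

def cap (k s X lo hi p t : ℕ) : ℕ :=
  Nat.rec 1 (fun e ih => Bool.rec ih (p ^ (e + 1)) (allowed k s X lo hi p (e + 1))) t

def capProd (k s X lo hi : ℕ) (l : List ℕ) : ℕ :=
  List.rec 1 (fun p _ ih => cap k s X lo hi p (Bool.rec 1 6 (Nat.ble p 9)) * ih) l

/-- Applies `f p m` to all `m ≤ N` obtained from `a` by multiplication with primes in `l` such
that `m` divides `M`, where `p` is the largest of these primes. -/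
def visit (f : ℕ → ℕ → Bool) (N M t : ℕ) : List ℕ → ℕ → Bool :=
  Nat.rec (fun _ _ => false) (fun _ ih l a =>
    List.rec true (fun p l' _ => withNat (Nat.mul a p) fun b =>
      Bool.rec true (andB (ih l' a)
        (Bool.rec true (andB (f p b) (ih l b)) (dvdB b M))) (Nat.ble b N)) l) t

def rootAux (X k b : ℕ) : ℕ → ℕ :=
  Nat.rec (fun y => y) (fun b ih y => Bool.rec (ih y) (ih (y + 2 ^ b))
    (Nat.ble ((y + 2 ^ b) ^ k) X)) b

def withBound (k s t : ℕ) : ℕ → (ℕ → Bool) → Bool :=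
  Nat.rec (fun X f => f X) (fun _ ih X f =>
    withNat (k.factorial * capProd k s X 0 (k - 1) smallPrimes) fun Y =>
      Bool.rec (ih Y f) (f X) (Nat.ble X Y)) t

def smallTest (k s : ℕ) : Bool :=
  withBound k s 12 (Nat.factorial 88 ^ k) fun X =>
    withNat (capProd k s X 0 (k - 1) smallPrimes) fun M =>
    withNat (rootAux X k 68 0) fun y => andB (Nat.ble (X + 1) ((y + 1) ^ k)) <|
    withNat (y + k - 1) fun N => andB (Nat.ble (N + s + 1) (2 ^ 70)) <|
    allB (fun i =>
      withNat (capProd k s X i i smallPrimes.dropLast) fun Mi =>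
      withNats (smallPrimes.reverse.filter fun p => dvdB p Mi) fun l =>
        visit (fun p m => withNat (m + i) fun n => leafTest k s M n p) N Mi 80 l 1)
      (List.range (min k 2))

def splitAll (f : ℕ → Bool) (t : ℕ) : ℕ → Bool :=
  Nat.rec f (fun t ih a => andB (ih a) (withNat (a + 2 ^ t) ih)) t

def maxPow (p B t : ℕ) : ℕ := Nat.rec 1 (fun _ ih => Bool.rec ih (ih * p) (Nat.ble (ih * p) B)) t

def maxPowProd (B : ℕ) (l : List ℕ) : ℕ := List.rec 1 (fun p _ ih => maxPow p B 7 * ih) l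

/-- The least `b ≤ t` such that `T < 2 ^ b`, if there is one. -/
def bitLength (T t : ℕ) : ℕ := Nat.rec 0 (fun b ih => Bool.rec (b + 1) ih (Nat.ble (T + 1) (2 ^ b))) t

def largeLeaf (k M n : ℕ) : Bool :=
  orB (Nat.ble (n + 1) (2 * k)) <| Bool.rec true
    (withNats (smallPrimes.filter fun p => andB (Nat.ble (k + 1) p) (Nat.ble (n % p + 1) k)) fun l =>
      allB (fun j => withNat (k + 1 + j) fun s => orB (Nat.ble s 8) (fullTest l n s k))
        (List.range (88 - k))) (windowTest M n k)

def largeTest (k : ℕ) : Bool :=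
  withNat (maxPowProd (87 + k) smallPrimes) fun M =>
    withNat (k.factorial * M) fun X => withNat (rootAux X k 40 0) fun y =>
    andB (Nat.ble (X + 1) ((y + 1) ^ k)) <| andB (Nat.ble (y + k + 88) (2 ^ 70)) <|
    withNat ((y + k - 1) / k) fun T =>
    withNat (bitLength T 20) fun b => andB (Nat.ble (T + 1) (2 ^ b)) <|
    splitAll (fun t => withNat (k * t) fun m => Bool.rec true
      (allB (fun j => withNat (m + j) (largeLeaf k M)) (List.range k)) (dvdB m M)) b 0

end Kernel

section KernelLemmas

theorem boolRec_eq {α : Type} (x y : α) (b : Bool) :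
    (Bool.rec x y b : α) = if b = true then y else x := by cases b <;> rfl

theorem andB_eq_true {b c : Bool} : andB b c = true ↔ b = true ∧ c = true := by
  cases b <;> simp [andB]

theorem orB_eq_true {b c : Bool} : orB b c = true ↔ b = true ∨ c = true := by
  cases b <;> simp [orB]

theorem anyB_eq_true {α : Type} {f : α → Bool} {l : List α} :
    anyB f l = true ↔ ∃ a ∈ l, f a = true := by
  induction l with
  | nil => simp [anyB]
  | cons a l ih =>
    rw [show anyB f (a :: l) = orB (f a) (anyB f l) from rfl, orB_eq_true, ih]
    simp

theorem allB_eq_true {α : Type} {f : α → Bool} {l : List α} :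
    allB f l = true ↔ ∀ a ∈ l, f a = true := by
  induction l with
  | nil => simp [allB]
  | cons a l ih =>
    rw [show allB f (a :: l) = andB (f a) (allB f l) from rfl, andB_eq_true, ih]
    simp

theorem withNat_eq (n : ℕ) (f : ℕ → Bool) : withNat n f = f n := by
  cases n <;> rfl

theorem withNats_eq (l : List ℕ) (f : List ℕ → Bool) : withNats l f = f l := by
  induction l generalizing f with
  | nil => rfl
  | cons a l ih =>
    rw [show withNats (a :: l) f = withNat a fun b => withNats l fun t => f (b :: t) from rfl,
      withNat_eq, ih]

theorem dvdB_eq_true {a b : ℕ} : dvdB a b = true ↔ a ∣ b := by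
  rw [Nat.dvd_iff_mod_eq_zero]
  exact iff_of_eq Nat.beq_eq

theorem mul_add_lt_of_lt_minVal {k p r V : ℕ} (h : V < minVal k p r) :
    k * ((p - 1) * V) + k * r < (p - 1) * (r + 1) := by
  rw [minVal] at h
  rcases Nat.eq_zero_or_pos (k * (p - 1)) with h0 | h0
  · rw [h0] at h; simp at h
  have := (Nat.le_div_iff_mul_le h0).mp h
  have e : k * ((p - 1) * V) + k * (p - 1) = V.succ * (k * (p - 1)) := by
    rw [Nat.succ_mul]; ring
  omega

theorem minVal_pos {k p r : ℕ} (hk : 0 < k) (hkp : k < p) : 0 < minVal k p r := by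
  rw [minVal]
  have h0 : 0 < k * (p - 1) := Nat.mul_pos hk (by omega)
  refine Nat.div_pos ?_ h0
  have h1 : k * r ≤ (p - 1) * r := Nat.mul_le_mul_right _ (by omega)
  have h2 : (p - 1) * (r + 1) = (p - 1) * r + (p - 1) := by ring
  omega

theorem minVal_mono {k p r r' : ℕ} (hkp : k < p) (h : r ≤ r') : minVal k p r ≤ minVal k p r' := by
  refine Nat.div_le_div_right (Nat.add_le_add_right ?_ _)
  obtain ⟨d, rfl⟩ := Nat.exists_eq_add_of_le h
  have h1 : k * d ≤ (p - 1) * d := Nat.mul_le_mul_right _ (by omega)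
  have h2 : (p - 1) * (r + d + 1) = (p - 1) * (r + 1) + (p - 1) * d := by ring
  have h3 : k * (r + d) = k * r + k * d := by ring
  omega

theorem exists_of_slopeLoop {n s k p V t j : ℕ} (h : slopeLoop n s k p V t j = true) :
    ∃ J, j ≤ J ∧ J ≤ j + t ∧ k * ((p - 1) * V) + k * (J - 1) < (p - 1) * J ∧ ∀ j', j ≤ j' → j' < J →
      k * (V + facVal p 10 j') < k * carries p 70 (n - j') s 0 + j' := by
  induction t generalizing j with
  | zero => cases h
  | succ t ih =>
    rw [show slopeLoop n s k p V (t + 1) j =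
      orB (Nat.ble (k * ((p - 1) * V) + k * (j - 1) + 1) ((p - 1) * j))
        (andB (Nat.ble (k * (V + facVal p 10 j) + 1) (k * carries p 70 (n - j) s 0 + j))
        (withNat (j + 1) (slopeLoop n s k p V t))) from rfl, withNat_eq, orB_eq_true, andB_eq_true,
      Nat.ble_eq, Nat.ble_eq] at h
    rcases h with h | ⟨h1, h2⟩
    · exact ⟨j, le_rfl, by omega, h, fun j' h1 h2 => by omega⟩
    · obtain ⟨J, hJ1, hJ2, hJ3, hJ4⟩ := ih h2
      refine ⟨J, by omega, by omega, hJ3, fun j' h3 h4 => ?_⟩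
      rcases h3.eq_or_lt with rfl | h3
      · exact h1
      · exact hJ4 j' h3 h4

variable {n s k p : ℕ} [hp : Fact p.Prime]

theorem padicValNat_choose_add_one_le {m : ℕ} (hc : n % p + s % p < p) (hm : 1 ≤ m)
    (h : n % p ^ (m + 1) + s < p ^ (m + 1)) : padicValNat p ((n + s).choose s) + 1 ≤ m := by
  have hp1 := hp.out.one_lt
  rw [padicValNat_choose' (b := Nat.log p (n + s) + 1) (Nat.lt_succ_self _)]
  have hsub : ((Ico 1 (Nat.log p (n + s) + 1)).filter
      fun i => p ^ i ≤ s % p ^ i + n % p ^ i) ⊆ Ico 2 (m + 1) := by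
    intro i hi
    rw [mem_filter, mem_Ico] at hi
    obtain ⟨⟨hi1, -⟩, hi2⟩ := hi
    rw [mem_Ico]
    constructor
    · by_contra! h2
      obtain rfl : i = 1 := by omega
      rw [pow_one] at hi2
      omega
    · by_contra! h2
      obtain ⟨d, rfl⟩ := Nat.exists_eq_add_of_le h2
      rw [pow_add, Nat.mod_mul (x := n)] at hi2
      have h3 : n / p ^ (m + 1) % p ^ d + 1 ≤ p ^ d := Nat.mod_lt _ (by positivity)
      have h4 : s % (p ^ (m + 1) * p ^ d) ≤ s := Nat.mod_le _ _
      have h5 := Nat.mul_le_mul_left (p ^ (m + 1)) h3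
      rw [mul_add] at h5
      omega
  have := card_le_card hsub
  rw [Nat.card_Ico] at this
  omega

theorem pow_add_padicValNat_choose_le {e i : ℕ} (hi : i ≤ n) (hdvd : p ^ e ∣ n - i)
    (hc : i + s % p < p) (hV : 0 < padicValNat p ((n + s).choose s)) :
    p ^ (e + padicValNat p ((n + s).choose s)) ≤ n + s := by
  have hp1 := hp.out.one_lt
  have hns : n + s ≠ 0 := by
    intro h
    obtain ⟨rfl, rfl⟩ : n = 0 ∧ s = 0 := by omega
    simp at hV
  rw [padicValNat_choose' (b := Nat.log p (n + s) + 1) (Nat.lt_succ_self _)] at hV ⊢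
  have hsub : ((Ico 1 (Nat.log p (n + s) + 1)).filter
      fun i => p ^ i ≤ s % p ^ i + n % p ^ i) ⊆ Ico (e + 1) (Nat.log p (n + s) + 1) := by
    intro j hj
    rw [mem_filter, mem_Ico] at hj
    obtain ⟨⟨hj1, hj2⟩, hj3⟩ := hj
    rw [mem_Ico]
    refine ⟨?_, hj2⟩
    by_contra! hje
    obtain ⟨j, rfl⟩ : ∃ j', j = j' + 1 := ⟨j - 1, by omega⟩
    have h1 : p ^ (j + 1) ∣ n - i := (pow_dvd_pow p (by omega)).trans hdvd
    have h2 : n % p ^ (j + 1) ≤ i := by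
      obtain ⟨a, ha⟩ := h1
      have : n = i + p ^ (j + 1) * a := by omega
      rw [this, Nat.add_mul_mod_self_left]
      exact Nat.mod_le _ _
    rw [pow_succ', Nat.mod_mul (x := s), ← pow_succ'] at hj3
    have h3 : s / p % p ^ j + 1 ≤ p ^ j := Nat.mod_lt _ (by positivity)
    have h5 := Nat.mul_le_mul_left p h3
    rw [mul_add, ← pow_succ'] at h5
    omega
  have h6 := card_le_card hsub
  rw [Nat.card_Ico] at h6
  exact (Nat.pow_le_pow_right hp.out.pos (by omega)).trans (Nat.pow_log_le_self p hns)

theorem not_hasFactor_of_residueTest (hkn : k ≤ n) (h : residueTest n s k p = true) :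
    ¬ HasFactor n s k := by
  intro hF
  simp only [residueTest, withNat_eq, andB_eq_true, orB_eq_true, Nat.ble_eq] at h
  obtain ⟨h1, h2, h3⟩ := h
  have hd : p ∣ n - n % p := Nat.dvd_sub_mod n
  rcases h3 with h3 | ⟨h3, h4⟩
  · have := hF.prime_le hkn hp.out h1 hd
    rw [le_max_iff] at this
    omega
  · have hpos := minVal_pos (k := k) (p := p) (r := n % p + s % p) (by omega) h2
    have := padicValNat_choose_add_one_le (n := n) (s := s) h3 hpos h4
    exact not_hasFactor_of_residue h2 hkn h1 hd h3 (mul_add_lt_of_lt_minVal this) hF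

theorem padicValNat_factorial_eq (m : ℕ) :
    padicValNat p m.factorial = m / p + padicValNat p (m / p).factorial := by
  rw [← padicValNat_mul_div_factorial, padicValNat_factorial_mul, add_comm]

theorem padicValNat_factorial_eq_facVal {t m : ℕ} (h : m < p ^ t) :
    padicValNat p m.factorial = facVal p t m := by
  induction t generalizing m with
  | zero =>
    obtain rfl : m = 0 := by simpa using h
    simp [facVal]
  | succ t ih =>
    rw [padicValNat_factorial_eq, ih (Nat.div_lt_of_lt_mul (by rwa [← pow_succ']))]
    rfl

theorem padicValNat_factorial_add_eq {t n s c : ℕ} (h : n + s + c < p ^ t) (hc : c ≤ 1) :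
    padicValNat p (n + s + c).factorial =
      padicValNat p n.factorial + padicValNat p s.factorial + carries p t n s c := by
  induction t generalizing n s c with
  | zero =>
    obtain ⟨rfl, rfl, rfl⟩ : n = 0 ∧ s = 0 ∧ c = 0 := by
      rw [pow_zero] at h; omega
    simp [carries]
  | succ t ih =>
    have hp1 := hp.out.one_lt
    rw [show carries p (t + 1) n s c = Bool.rec (Bool.rec (carries p t (n / p) (s / p) 0)
      (carries p t (n / p) (s / p) 1 + 1) (Nat.ble p (n % p + s % p + c))) 0
      (Nat.ble (s + c) 0) from rfl, boolRec_eq, boolRec_eq]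
    simp only [Nat.ble_eq]
    have h1 := Nat.div_add_mod n p
    have h2 := Nat.div_add_mod s p
    have h3 := Nat.mod_lt n hp.out.pos
    have h4 := Nat.mod_lt s hp.out.pos
    have h5 : (n + s + c) / p < p ^ t := Nat.div_lt_of_lt_mul (by rwa [← pow_succ'])
    have key : ∀ d ≤ 1, (n + s + c) / p = n / p + s / p + d →
        padicValNat p (n + s + c).factorial = padicValNat p n.factorial +
          padicValNat p s.factorial + (carries p t (n / p) (s / p) d + d) := by
      intro d hd he
      rw [padicValNat_factorial_eq (n + s + c), padicValNat_factorial_eq n,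
        padicValNat_factorial_eq s, he, ih (he ▸ h5) hd]
      ring
    split_ifs with h6 h7
    · obtain ⟨rfl, rfl⟩ : s = 0 ∧ c = 0 := by omega
      simp
    · exact key 1 le_rfl (Nat.div_eq_of_lt_le (by ring_nf at *; omega) (by ring_nf at *; omega))
    · exact key 0 (by omega)
        (Nat.div_eq_of_lt_le (by ring_nf at *; omega) (by ring_nf at *; omega))

theorem padicValNat_choose_eq_carries {t : ℕ} (h : n + s < p ^ t) :
    padicValNat p ((n + s).choose s) = carries p t n s 0 := by
  have h1 := padicValNat_factorial_add_eq (p := p) (c := 0) h zero_le_one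
  have h2 := congrArg (padicValNat p) (Nat.add_choose_mul_factorial_mul_factorial n s)
  rw [padicValNat.mul (Nat.mul_ne_zero (Nat.choose_pos (by omega)).ne' n.factorial_ne_zero)
    s.factorial_ne_zero, padicValNat.mul (Nat.choose_pos (by omega)).ne' n.factorial_ne_zero] at h2
  rw [add_zero] at h1
  omega

theorem not_hasFactor_of_slopeTest (hkn : k ≤ n) (hb : n + s < 2 ^ 70)
    (h : slopeTest n s k p = true) : ¬ HasFactor n s k := by
  simp only [slopeTest, withNat_eq, andB_eq_true, orB_eq_true, Nat.ble_eq] at h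
  obtain ⟨h1, h2, h3⟩ := h
  have hb' : n + s < p ^ 70 := hb.trans_le (Nat.pow_le_pow_left hp.out.two_le _)
  rw [← padicValNat_choose_eq_carries hb'] at h3
  obtain ⟨J, -, hJ2, hJ3, hJ4⟩ := exists_of_slopeLoop h3
  refine not_hasFactor_of_slope_of_lt h1 hkn (fun j hj => ?_) (fun j hj0 hjJ => ?_) hJ3
  · rcases h2 with h2 | h2
    · exact dvd_gCoeff_of_dvd_sub (Nat.dvd_sub_mod n) (by omega)
    · have := Nat.mod_lt s hp.out.pos
      have h4 := Nat.div_add_mod s p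
      refine dvd_gCoeff_of_dvd_add (t := p - s % p) ⟨s / p + 1, ?_⟩ (by omega) (by omega)
      rw [mul_add, mul_one]
      omega
  · have h5 : j < p ^ 10 :=
      lt_of_lt_of_le (by omega) (Nat.pow_le_pow_left hp.out.two_le 10)
    rw [padicValNat_factorial_eq_facVal h5,
      padicValNat_choose_eq_carries (n := n - j) (lt_of_le_of_lt (by omega) hb')]
    exact hJ4 j hj0 hjJ

end KernelLemmas

section Soundness

theorem mem_smallPrimes {p : ℕ} (hp : p.Prime) (h : p ≤ 89) : p ∈ smallPrimes := by
  revert hp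
  interval_cases p <;> simp [smallPrimes] <;> norm_num

theorem prime_of_mem_smallPrimes {p : ℕ} (h : p ∈ smallPrimes) : p.Prime := by
  simp only [smallPrimes, List.mem_cons, List.not_mem_nil, or_false] at h
  rcases h with rfl | rfl | rfl | rfl | rfl | rfl | rfl | rfl | rfl | rfl | rfl | rfl | rfl | rfl |
    rfl | rfl | rfl | rfl | rfl | rfl | rfl | rfl | rfl | rfl <;> norm_num

variable {n s k : ℕ}

theorem exists_pow_padicValNat_choose_dvd {p : ℕ} [hp : Fact p.Prime] (hk : 0 < k) (hkn : k ≤ n) :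
    ∃ i < k, p ^ padicValNat p (n.choose k) ∣ n - i := by
  obtain ⟨m, rfl⟩ := Nat.exists_eq_add_of_le' hkn
  rw [padicValNat_choose' (b := Nat.log p (m + k) + 1) (Nat.lt_succ_self _)]
  set S := (Ico 1 (Nat.log p (m + k) + 1)).filter fun i => p ^ i ≤ k % p ^ i + m % p ^ i with hS
  rcases S.eq_empty_or_nonempty with h | h
  · rw [h]; exact ⟨0, hk, by simp⟩
  have hm := S.max'_mem h
  set j := S.max' h
  have hsub : S ⊆ Icc 1 j := fun i hi =>
    mem_Icc.mpr ⟨(mem_Ico.mp (mem_filter.mp hi).1).1, S.le_max' i hi⟩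
  have hcard := card_le_card hsub
  rw [Nat.card_Icc] at hcard
  have hq : 0 < p ^ j := Nat.pow_pos hp.out.pos
  have h1 := (mem_filter.mp hm).2
  have h2 : (m + k) % p ^ j = m % p ^ j + k % p ^ j - p ^ j := by
    have h3 := Nat.mod_lt m hq
    have h4 := Nat.mod_lt k hq
    rw [Nat.add_mod, Nat.mod_eq_sub_mod (by omega), Nat.mod_eq_of_lt (by omega)]
  have h3 := Nat.mod_lt m hq
  have h4 := Nat.mod_le k (p ^ j)
  exact ⟨(m + k) % p ^ j, by omega, (pow_dvd_pow p (by omega)).trans (Nat.dvd_sub_mod _)⟩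

theorem pow_le_factorial_mul {M : ℕ} (hM : 0 < M) (hk : 0 < k) (hkn : k ≤ n)
    (h : ∀ p e i, p.Prime → 1 ≤ e → i < k → p ^ e ∣ n - i → p ^ e ∣ M) :
    (n + 1 - k) ^ k ≤ k.factorial * M := by
  refine (Nat.pow_sub_le_descFactorial n k).trans ?_
  rw [Nat.descFactorial_eq_factorial_mul_choose]
  refine Nat.mul_le_mul_left _ (Nat.le_of_dvd hM ?_)
  rw [Nat.dvd_iff_prime_pow_dvd_dvd]
  intro p e hp hdvd
  have := Fact.mk hp
  rcases Nat.eq_zero_or_pos e with rfl | he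
  · simp
  obtain ⟨i, hi, hd⟩ := exists_pow_padicValNat_choose_dvd (p := p) hk hkn
  refine h p e i hp he hi ((pow_dvd_pow p ?_).trans hd)
  exact (padicValNat_dvd_iff_le (Nat.choose_pos hkn).ne').mp hdvd

theorem dvd_of_forall_prime_pow {m M : ℕ}
    (h : ∀ p e, p.Prime → 1 ≤ e → p ^ e ∣ m → p ^ e ∣ M) : m ∣ M := by
  rw [Nat.dvd_iff_prime_pow_dvd_dvd]
  intro p e hp hd
  rcases Nat.eq_zero_or_pos e with rfl | he
  · simp
  · exact h p e hp he hd

theorem le_of_pow_lt {X y : ℕ} (hkn : k ≤ n) (h : (n + 1 - k) ^ k ≤ X) (hy : X < (y + 1) ^ k) :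
    n ≤ y + k - 1 := by
  have := lt_of_pow_lt_pow_left₀ k (Nat.zero_le _) (h.trans_lt hy)
  omega

theorem not_hasFactor_of_fullTest {l : List ℕ} (hl : ∀ p ∈ l, p.Prime) (hkn : k ≤ n)
    (hb : n + s < 2 ^ 70) (hex : exceptional n s k = false) (h : fullTest l n s k = true) :
    ¬ HasFactor n s k := by
  rw [fullTest, orB_eq_true, orB_eq_true, anyB_eq_true, anyB_eq_true, hex] at h
  rcases h with ⟨p, hp, h⟩ | ⟨p, hp, h⟩ | h
  · have := Fact.mk (hl p hp)
    exact not_hasFactor_of_residueTest hkn h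
  · have := Fact.mk (prime_of_mem_smallPrimes hp)
    exact not_hasFactor_of_slopeTest hkn hb h
  · cases h

theorem allowed_eq_true {X lo hi p e i : ℕ} (hF : HasFactor n s k) (hkn : k ≤ n) (hp : p.Prime)
    (hlo : lo ≤ i) (hhi : i ≤ hi) (hik : i < k) (he : 1 ≤ e) (hdvd : p ^ e ∣ n - i)
    (hX : (n + 1 - k) ^ k ≤ X) : allowed k s X lo hi p e = true := by
  have := Fact.mk hp
  have hpd : p ∣ n - i := (dvd_pow_self p (by omega)).trans hdvd
  simp only [allowed, andB_eq_true, orB_eq_true, Nat.ble_eq]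
  refine ⟨(hF.pow_le hkn hp hik hdvd).trans (by omega), ?_⟩
  by_cases hpk : p ≤ k
  · exact Or.inl hpk
  have h1 := hF.prime_le hkn hp hik hpd
  refine Or.inr ⟨by omega, ?_⟩
  by_cases hps : p ≤ hi + s % p
  · exact Or.inl hps
  refine Or.inr (le_trans (Nat.pow_le_pow_left ?_ k) hX)
  have h2 : minVal k p (i + s % p) ≤ padicValNat p ((n + s).choose s) := by
    by_contra! hc
    exact not_hasFactor_of_residue (by omega) hkn hik hpd (by omega)
      (mul_add_lt_of_lt_minVal hc) hF
  have h3 := minVal_mono (k := k) (p := p) (by omega) (Nat.add_le_add_right hlo (s % p))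
  have h4 := pow_add_padicValNat_choose_le (by omega) hdvd (by omega)
    (lt_of_lt_of_le (minVal_pos (by omega) (by omega)) h2)
  have h5 := Nat.pow_le_pow_right hp.pos (Nat.add_le_add_left (h3.trans h2) e)
  omega

theorem pow_dvd_cap {X lo hi p e t : ℕ} (het : e ≤ t)
    (h : 1 ≤ e → allowed k s X lo hi p e = true) : p ^ e ∣ cap k s X lo hi p t := by
  induction t with
  | zero =>
    obtain rfl : e = 0 := by omega
    simp
  | succ t ih =>
    rw [show cap k s X lo hi p (t + 1) = Bool.rec (cap k s X lo hi p t) (p ^ (t + 1))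
      (allowed k s X lo hi p (t + 1)) from rfl, boolRec_eq]
    split_ifs with ha
    · exact pow_dvd_pow p het
    · rcases het.eq_or_lt with rfl | hlt
      · exact absurd (h (by omega)) ha
      · exact ih (by omega)

theorem cap_pos {X lo hi p t : ℕ} (hp : 0 < p) : 0 < cap k s X lo hi p t := by
  induction t with
  | zero => exact one_pos
  | succ t ih =>
    rw [show cap k s X lo hi p (t + 1) = Bool.rec (cap k s X lo hi p t) (p ^ (t + 1))
      (allowed k s X lo hi p (t + 1)) from rfl, boolRec_eq]
    split_ifs
    · exact Nat.pow_pos hp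
    · exact ih

theorem capProd_pos {X lo hi : ℕ} {l : List ℕ} (hl : ∀ p ∈ l, 0 < p) :
    0 < capProd k s X lo hi l := by
  induction l with
  | nil => exact one_pos
  | cons p l ih =>
    exact Nat.mul_pos (cap_pos (hl p (by simp))) (ih fun q hq => hl q (by simp [hq]))

theorem cap_dvd_capProd {X lo hi p : ℕ} {l : List ℕ} (hl : p ∈ l) :
    cap k s X lo hi p (if p ≤ 9 then 6 else 1) ∣ capProd k s X lo hi l := by
  induction l with
  | nil => simp at hl
  | cons q l ih =>
    rw [show capProd k s X lo hi (q :: l) = cap k s X lo hi q (Bool.rec 1 6 (Nat.ble q 9)) *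
      capProd k s X lo hi l from rfl, boolRec_eq]
    simp only [Nat.ble_eq]
    rcases List.mem_cons.mp hl with rfl | hl
    · exact dvd_mul_right _ _
    · exact (ih hl).mul_left _

theorem pow_dvd_capProd {X lo hi p e i : ℕ} {l : List ℕ} (hF : HasFactor n s k) (hkn : k ≤ n)
    (hk7 : k ≤ 7) (hs : s ≤ 88) (hp : p.Prime) (hlo : lo ≤ i) (hhi : i ≤ hi) (hik : i < k)
    (he : 1 ≤ e) (hdvd : p ^ e ∣ n - i) (hX : (n + 1 - k) ^ k ≤ X) (hpl : p ∈ l) :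
    p ^ e ∣ capProd k s X lo hi l := by
  refine (pow_dvd_cap ?_ fun _ => allowed_eq_true hF hkn hp hlo hhi hik he hdvd hX).trans
    (cap_dvd_capProd hpl)
  have h1 : p ^ e ≤ 94 := (hF.pow_le hkn hp hik hdvd).trans (by omega)
  by_contra! hc
  split_ifs at hc with h9
  · have h2 := Nat.pow_le_pow_right (n := 2) (by norm_num) hc
    have h3 := Nat.pow_le_pow_left hp.two_le e
    norm_num at h2
    omega
  · have h2 := Nat.pow_le_pow_right hp.pos hc
    have h3 : 10 * 10 ≤ p * p := Nat.mul_le_mul (by omega) (by omega)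
    rw [show Nat.succ 1 = 2 from rfl, pow_two] at h2
    omega

theorem pow_dvd_capProd_smallPrimes {X p e i : ℕ} (hF : HasFactor n s k) (hkn : k ≤ n)
    (hk7 : k ≤ 7) (hs : s ≤ 88) (hX : (n + 1 - k) ^ k ≤ X) (hp : p.Prime) (he : 1 ≤ e) (hik : i < k)
    (hdvd : p ^ e ∣ n - i) : p ^ e ∣ capProd k s X 0 (k - 1) smallPrimes := by
  have := hF.prime_le hkn hp hik ((dvd_pow_self p (by omega)).trans hdvd)
  exact pow_dvd_capProd hF hkn hk7 hs hp (by omega) (by omega) hik he hdvd hX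
    (mem_smallPrimes hp (by omega))

theorem visit_sound {f : ℕ → ℕ → Bool} {N M t : ℕ} {l : List ℕ} {a c : ℕ}
    (h : visit f N M t l a = true) (hl : l.Pairwise (· ≤ ·)) (hM : a * c ∣ M) (hN : a * c ≤ N)
    (hc : 1 < c) (hcl : ∀ q, q.Prime → q ∣ c → q ∈ l) : ∃ p ∈ l, f p (a * c) = true := by
  induction t generalizing l a c with
  | zero => cases h
  | succ t ih =>
    obtain ⟨q, hq, hqc⟩ := Nat.exists_prime_and_dvd hc.ne'
    have hql := hcl q hq hqc
    cases l with
    | nil => simp at hql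
    | cons p l =>
      rw [show visit f N M (t + 1) (p :: l) a = withNat (Nat.mul a p) fun b =>
        Bool.rec true (andB (visit f N M t l a) (Bool.rec true
          (andB (f p b) (visit f N M t (p :: l) b)) (dvdB b M))) (Nat.ble b N) from rfl,
        withNat_eq, Nat.mul_eq, boolRec_eq, boolRec_eq] at h
      rw [List.pairwise_cons] at hl
      have hpq : p ≤ q := by
        rcases List.mem_cons.mp hql with rfl | hql
        · exact le_rfl
        · exact hl.1 q hql
      have hpN : a * p ≤ N :=
        (Nat.mul_le_mul_left a (hpq.trans (Nat.le_of_dvd (by omega) hqc))).trans hN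
      rw [if_pos (Nat.ble_eq.mpr hpN), andB_eq_true] at h
      by_cases hpc : p ∣ c
      · obtain ⟨c, rfl⟩ := hpc
        rw [← mul_assoc] at hM hN ⊢
        rw [if_pos (dvdB_eq_true.mpr ((dvd_mul_right _ _).trans hM)), andB_eq_true] at h
        rcases Nat.lt_or_ge 1 c with hc1 | hc1
        · exact ih h.2.2 (List.pairwise_cons.mpr hl) hM hN hc1
            fun q hq hqc => hcl q hq (hqc.mul_left _)
        · obtain rfl : c = 1 := by
            rcases Nat.eq_zero_or_pos c with rfl | hc0
            · simp at hc
            · omega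
          exact ⟨p, by simp, by simpa using h.2.1⟩
      · obtain ⟨q, hq, hf⟩ := ih h.1 hl.2 hM hN hc fun q hq hqc => by
          rcases List.mem_cons.mp (hcl q hq hqc) with rfl | hql
          · exact absurd hqc hpc
          · exact hql
        exact ⟨q, by simp [hq], hf⟩

theorem exists_of_withBound {X t : ℕ} {f : ℕ → Bool} (hF : HasFactor n s k) (hk : 0 < k)
    (hkn : k ≤ n) (hk7 : k ≤ 7) (hs : s ≤ 88) (hX : (n + 1 - k) ^ k ≤ X)
    (h : withBound k s t X f = true) : ∃ Y, (n + 1 - k) ^ k ≤ Y ∧ f Y = true := by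
  induction t generalizing X with
  | zero => exact ⟨X, hX, h⟩
  | succ t ih =>
    rw [show withBound k s (t + 1) X f =
      withNat (k.factorial * capProd k s X 0 (k - 1) smallPrimes) fun Y =>
        Bool.rec (withBound k s t Y f) (f X) (Nat.ble X Y) from rfl, withNat_eq, boolRec_eq] at h
    split_ifs at h
    · exact ⟨X, hX, h⟩
    · exact ih (pow_le_factorial_mul
        (capProd_pos fun p hp => (prime_of_mem_smallPrimes hp).pos) hk hkn
        fun p e i hp he hi hd => pow_dvd_capProd_smallPrimes hF hkn hk7 hs hX hp he hi hd) h

theorem HasFactor.le_factorial (hF : HasFactor n s k) (hk : 0 < k) (hkn : k ≤ n) (hks : k ≤ s)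
    (hs : s ≤ 88) : n ≤ Nat.factorial 88 := by
  refine Nat.le_of_dvd (Nat.factorial_pos _) (dvd_of_forall_prime_pow fun p e hp he hd => ?_)
  have := hF.pow_le hkn hp hk (i := 0) hd
  exact Nat.dvd_factorial (Nat.pow_pos hp.pos) (by omega)

theorem exists_odd_sub (hF : HasFactor n s k) (hk : 0 < k) (h2 : 2 * k ≤ n) :
    ∃ i < min k 2, Odd (n - i) ∧ 1 < n - i := by
  rcases Nat.even_or_odd n with he | ho
  · have : k ≠ 1 := by
      rintro rfl
      exact (Nat.not_odd_iff_even.mpr he) hF.odd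
    refine ⟨1, by omega, ?_, by omega⟩
    exact Nat.Even.sub_odd (by omega) he odd_one
  · exact ⟨0, by omega, ho, by omega⟩

theorem windowTest_eq_true {M : ℕ} (h : ∀ i < k, n - i ∣ M) : windowTest M n k = true := by
  rw [windowTest, allB_eq_true]
  intro i hi
  exact dvdB_eq_true.mpr (h i (List.mem_range.mp hi))

theorem not_hasFactor_of_smallTest (hk : 0 < k) (hk7 : k ≤ 7) (hks : k ≤ s) (hs : s ≤ 88)
    (h2 : 2 * k ≤ n) (hex : exceptional n s k = false) (h : smallTest k s = true) :
    ¬ HasFactor n s k := by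
  intro hF
  have hkn : k ≤ n := by omega
  have hle := hF.le_factorial hk hkn hks hs
  unfold smallTest at h
  generalize Nat.factorial 88 = F at h hle
  obtain ⟨X, hX, h⟩ := exists_of_withBound hF hk hkn hk7 hs
    (Nat.pow_le_pow_left ((by omega : n + 1 - k ≤ n).trans hle) k) h
  simp only [withNat_eq, withNats_eq, andB_eq_true, allB_eq_true, Nat.ble_eq, List.mem_range] at h
  obtain ⟨hy, hb, h⟩ := h
  have hN := le_of_pow_lt hkn hX hy
  obtain ⟨i, hi, hodd, h1⟩ := exists_odd_sub hF hk h2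
  have hik : i < k := by omega
  have hmem : ∀ p, p.Prime → p ∣ n - i → p ∈ smallPrimes.dropLast := by
    intro p hp hd
    have h3 := mem_smallPrimes hp ((hF.prime_le hkn hp hik hd).trans (by omega))
    have h4 : p ≠ 2 := by
      rintro rfl
      exact (Nat.not_even_iff_odd.mpr hodd) (even_iff_two_dvd.mpr hd)
    have h5 : ∀ p ∈ smallPrimes, p = 2 ∨ p ∈ smallPrimes.dropLast := by decide
    exact (h5 p h3).resolve_left h4
  have hM : n - i ∣ capProd k s X i i smallPrimes.dropLast :=
    dvd_of_forall_prime_pow fun p e hp he hd =>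
      pow_dvd_capProd hF hkn hk7 hs hp le_rfl le_rfl hik he hd hX
        (hmem p hp ((dvd_pow_self p (by omega)).trans hd))
  obtain ⟨p, hp, hf⟩ := visit_sound (c := n - i) (h i hi) (List.Pairwise.filter _ (by decide))
    (by rwa [one_mul]) (by omega) h1 fun q hq hqd => by
      rw [List.mem_filter, List.mem_reverse]
      exact ⟨List.mem_of_mem_dropLast (hmem q hq hqd), dvdB_eq_true.mpr (hqd.trans hM)⟩
  rw [List.mem_filter, List.mem_reverse] at hp
  rw [one_mul, Nat.sub_add_cancel (by omega), leafTest, windowTest_eq_true fun i hi =>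
    dvd_of_forall_prime_pow fun p e hp he hd =>
      pow_dvd_capProd_smallPrimes hF hkn hk7 hs hX hp he hi hd, orB_eq_true, orB_eq_true,
    Nat.ble_eq] at hf
  rcases hf with hf | hf | hf
  · have := Fact.mk (prime_of_mem_smallPrimes hp.1)
    exact not_hasFactor_of_residueTest hkn hf hF
  · omega
  · exact not_hasFactor_of_fullTest (fun p hp => prime_of_mem_smallPrimes hp) hkn
      (by omega) hex hf hF

theorem exists_maxPow_eq {p B t : ℕ} (hp : 0 < p) :
    ∃ j, maxPow p B t = p ^ j ∧ j ≤ t ∧ ∀ e ≤ t, p ^ e ≤ B → e ≤ j := by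
  induction t with
  | zero => exact ⟨0, rfl, le_rfl, fun e he _ => he⟩
  | succ t ih =>
    obtain ⟨j, hj, hjt, h⟩ := ih
    rw [show maxPow p B (t + 1) = Bool.rec (maxPow p B t) (maxPow p B t * p)
      (Nat.ble (maxPow p B t * p) B) from rfl, boolRec_eq, hj, ← pow_succ]
    have hstep : ∀ e ≤ t + 1, p ^ e ≤ B → e ≤ j ∨ e = t + 1 ∧ j = t := by
      intro e he heB
      rcases he.eq_or_lt with rfl | he
      · have := h t le_rfl ((Nat.pow_le_pow_right hp (Nat.le_succ t)).trans heB)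
        omega
      · exact Or.inl (h e (by omega) heB)
    split_ifs with hB
    · refine ⟨j + 1, rfl, by omega, fun e he heB => ?_⟩
      have := hstep e he heB
      omega
    · refine ⟨j, rfl, by omega, fun e he heB => ?_⟩
      rcases hstep e he heB with h1 | ⟨rfl, rfl⟩
      · exact h1
      · exact absurd (Nat.ble_eq.mpr heB) hB

theorem maxPowProd_pos {B : ℕ} {l : List ℕ} (hl : ∀ p ∈ l, 0 < p) :
    0 < maxPowProd B l := by
  induction l with
  | nil => exact one_pos
  | cons p l ih =>
    refine Nat.mul_pos ?_ (ih fun q hq => hl q (by simp [hq]))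
    obtain ⟨j, hj, -⟩ := exists_maxPow_eq (B := B) (t := 7) (hl p (by simp))
    rw [hj]
    exact Nat.pow_pos (hl p (by simp))

theorem pow_dvd_maxPowProd {p e B : ℕ} {l : List ℕ} (hp : p.Prime) (hpl : p ∈ l) (hB : B < 2 ^ 8)
    (he : p ^ e ≤ B) : p ^ e ∣ maxPowProd B l := by
  induction l with
  | nil => simp at hpl
  | cons q l ih =>
    rcases List.mem_cons.mp hpl with rfl | hpl
    · refine Dvd.dvd.mul_right ?_ _
      obtain ⟨j, hj, -, h⟩ := exists_maxPow_eq (B := B) (t := 7) hp.pos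
      rw [hj]
      refine pow_dvd_pow p (h e ?_ he)
      by_contra! hc
      have h2 := Nat.pow_le_pow_right (n := 2) (by norm_num) (show 8 ≤ e from hc)
      have h3 := Nat.pow_le_pow_left hp.two_le e
      omega
    · exact (ih hpl).mul_left _

theorem splitAll_sound {f : ℕ → Bool} {t a b : ℕ} (h : splitAll f t a = true) (hab : a ≤ b)
    (hb : b < a + 2 ^ t) : f b = true := by
  induction t generalizing a with
  | zero =>
    obtain rfl : a = b := by simp at hb; omega
    exact h
  | succ t ih =>
    rw [show splitAll f (t + 1) a = andB (splitAll f t a) (withNat (a + 2 ^ t) (splitAll f t))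
      from rfl, andB_eq_true, withNat_eq] at h
    rw [pow_succ] at hb
    rcases lt_or_ge b (a + 2 ^ t) with hlt | hge
    · exact ih h.1 hab hlt
    · exact ih h.2 hge (by omega)

theorem exceptional_eq_false (hk : 5 ≤ k) : exceptional n s k = false := by
  rw [Bool.eq_false_iff, ne_eq, exceptional, anyB_eq_true]
  rintro ⟨x, hx, h⟩
  rw [andB_eq_true] at h
  have h1 : k = x.1 := Nat.eq_of_beq_eq_true h.1
  have h2 : ∀ x ∈ exceptions, x.1 < 5 := by decide
  have := h2 x hx
  omega

theorem not_hasFactor_of_largeTest (hk : 8 ≤ k) (hks : k < s) (hs : s ≤ 88) (h2 : 2 * k ≤ n)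
    (h : largeTest k = true) : ¬ HasFactor n s k := by
  intro hF
  have hkn : k ≤ n := by omega
  simp only [largeTest, withNat_eq, andB_eq_true, Nat.ble_eq] at h
  have hMpos : 0 < maxPowProd (87 + k) smallPrimes :=
    maxPowProd_pos fun p hp => (prime_of_mem_smallPrimes hp).pos
  have hpow : ∀ p e i, p.Prime → 1 ≤ e → i < k → p ^ e ∣ n - i →
      p ^ e ∣ maxPowProd (87 + k) smallPrimes := by
    intro p e i hp he hi hd
    have h3 := hF.prime_le hkn hp hi ((dvd_pow_self p (by omega)).trans hd)
    have h4 := hF.pow_le hkn hp hi hd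
    exact pow_dvd_maxPowProd hp (mem_smallPrimes hp (by omega)) (by omega) (by omega)
  generalize maxPowProd (87 + k) smallPrimes = M at h hMpos hpow
  generalize rootAux (k.factorial * M) k 40 0 = y at h
  obtain ⟨hy, hb, hT, h⟩ := h
  generalize bitLength ((y + k - 1) / k) 20 = b at h hT
  have hdvd : ∀ i < k, n - i ∣ M := fun i hi =>
    dvd_of_forall_prime_pow fun p e hp he hd => hpow p e i hp he hi hd
  have hN := le_of_pow_lt hkn (pow_le_factorial_mul hMpos (by omega) hkn hpow) hy
  have hmod := Nat.mod_lt n (show 0 < k by omega)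
  have hdm := Nat.div_add_mod n k
  have h3 := splitAll_sound h (Nat.zero_le (n / k)) (by
    rw [zero_add]
    exact lt_of_lt_of_le (Nat.lt_succ_of_le (Nat.div_le_div_right hN)) hT)
  rw [boolRec_eq, if_pos (dvdB_eq_true.mpr
    ((by omega : k * (n / k) = n - n % k) ▸ hdvd _ hmod)), allB_eq_true] at h3
  have h4 := h3 (n % k) (List.mem_range.mpr hmod)
  rw [hdm, largeLeaf, windowTest_eq_true hdvd, orB_eq_true, withNats_eq, allB_eq_true,
    Nat.ble_eq] at h4
  rcases h4 with h4 | h4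
  · omega
  have h5 := h4 (s - (k + 1)) (List.mem_range.mpr (by omega))
  rw [withNat_eq, orB_eq_true, Nat.ble_eq, show k + 1 + (s - (k + 1)) = s by omega] at h5
  rcases h5 with h5 | h5
  · omega
  · refine not_hasFactor_of_fullTest (fun p hp => prime_of_mem_smallPrimes
      (List.mem_of_mem_filter hp)) hkn (by omega) (exceptional_eq_false (by omega)) h5 hF

end Soundness

section Exceptions

/-- Every edge of the `p`-adic Newton polygon over `[i₁, i₀]` has slope in `[A₀ / B₀, A₁ / B₁)`, and
no fraction with denominator at most `k` lies in this interval. -/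
def SlopesBetween (n s k p A₁ B₁ i₁ A₀ B₀ i₀ : ℕ) : Prop :=
  (0 < A₀ ∧ i₁ ≤ n ∧ i₀ ≤ n ∧ n + s < 2 ^ 10 ∧ n + i₁ < i₀ + k ∧ A₁ * k ≤ B₁ * 16) ∧
  (∀ j < n + 1, i₁ < j →
    B₁ * (facVal p 10 n + carries p 10 (n - i₁) s 0 - facVal p 10 i₁) + A₁ * i₁ <
      B₁ * (facVal p 10 n + carries p 10 (n - j) s 0 - facVal p 10 j) + A₁ * j) ∧
  (∀ j < i₀, B₀ * (facVal p 10 n + carries p 10 (n - i₀) s 0 - facVal p 10 i₀) + A₀ * i₀ ≤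
    B₀ * (facVal p 10 n + carries p 10 (n - j) s 0 - facVal p 10 j) + A₀ * j) ∧
  ∀ d < k + 1, ∀ D < 16, 1 ≤ d → A₀ * d ≤ B₀ * D → A₁ * d ≤ B₁ * D

instance (n s k p A₁ B₁ i₁ A₀ B₀ i₀ : ℕ) :
    Decidable (SlopesBetween n s k p A₁ B₁ i₁ A₀ B₀ i₀) := by
  unfold SlopesBetween; infer_instance

variable {n s k : ℕ}

theorem not_hasFactor_of_slopesBetween (p A₁ B₁ i₁ A₀ B₀ i₀ : ℕ)
    (h : p.Prime ∧ SlopesBetween n s k p A₁ B₁ i₁ A₀ B₀ i₀) : ¬ HasFactor n s k := by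
  obtain ⟨hp, ⟨hA₀, hi₁, hi₀, hns, hlen, hk⟩, h₁, h₀, h⟩ := h
  have := Fact.mk hp
  have hns' : n + s < p ^ 10 := hns.trans_le (Nat.pow_le_pow_left hp.two_le _)
  have hv : ∀ j ≤ n, padicValNat p (gCoeff n s j) =
      facVal p 10 n + carries p 10 (n - j) s 0 - facVal p 10 j := by
    intro j hj
    have h2 := padicValNat_gCoeff (p := p) s hj
    rw [padicValNat_factorial_eq_facVal (p := p) (t := 10) (by omega : n < p ^ 10),
      padicValNat_factorial_eq_facVal (p := p) (t := 10) (by omega : j < p ^ 10),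
      padicValNat_choose_eq_carries (p := p) (t := 10) (by omega)] at h2
    omega
  intro hF
  obtain ⟨d, D, hd1, hdk, hd₀, hd₁⟩ := hF.exists_slope p hA₀ hi₁ hi₀
    (fun j hij hj => by rw [hv j hj, hv i₁ hi₁]; exact h₁ j (by omega) hij)
    (fun j hj => by rw [hv j (by omega), hv i₀ hi₀]; exact h₀ j hj) hlen
  have hD : D < 16 := by
    have := Nat.mul_le_mul_left A₁ hdk
    exact Nat.lt_of_mul_lt_mul_left (a := B₁) (by omega)
  have := h d (by omega) D hD hd1 hd₀
  omega

theorem not_hasFactor_one_of_eval_ne_zero (p : ℕ)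
    (h : ∀ x : ZMod p, ∑ j ∈ range (n + 1), (gCoeff n s j : ZMod p) * x ^ j ≠ 0) :
    ¬ HasFactor n s 1 := by
  rintro ⟨f, g, hf, -, hfg, hdeg⟩
  have h1 : (gInt n s).eval (-f.coeff 0) = 0 := by
    have := hf.eq_X_add_C hdeg
    rw [← hfg, eval_mul, this]
    simp
  refine h ((-f.coeff 0 : ℤ) : ZMod p) ?_
  have h2 := congrArg (Int.cast : ℤ → ZMod p) h1
  simpa [gInt, eval_finsetSum] using h2

theorem not_hasFactor_two_9_47 : ¬ HasFactor 9 47 2 := by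
  rintro ⟨f, g, hf, hg, hfg, hdeg⟩
  have hgdeg : g.natDegree = 7 := by
    have := hf.natDegree_mul hg
    rw [hfg, gInt_natDegree] at this
    omega
  have hf2 : f = X ^ 2 + C (f.coeff 1) * X + C (f.coeff 0) := by
    have := hf.as_sum
    rw [hdeg, sum_range_succ, sum_range_one, pow_zero, pow_one, mul_one] at this
    exact this.trans (by ring)
  generalize f.coeff 1 = b at hf2
  generalize f.coeff 0 = c at hf2
  have hz : ∀ j, 7 < j → g.coeff j = 0 := fun j hj => coeff_eq_zero_of_natDegree_lt (by omega)
  have h0 : c * g.coeff 0 = (gInt 9 47).coeff 0 := by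
    rw [← hfg, hf2]; simp [mul_coeff_zero]
  have h1 : b * g.coeff 0 + c * g.coeff 1 = (gInt 9 47).coeff 1 := by
    rw [← hfg, hf2, add_mul, add_mul, coeff_add, coeff_add, mul_assoc, coeff_C_mul, coeff_C_mul,
      coeff_X_mul, coeff_X_pow_mul']
    simp
  have h2 : ∀ j, g.coeff j + b * g.coeff (j + 1) + c * g.coeff (j + 2) =
      (gInt 9 47).coeff (j + 2) := by
    intro j
    rw [← hfg, hf2, add_mul, add_mul, coeff_add, coeff_add, mul_assoc, coeff_C_mul, coeff_C_mul,
      coeff_X_mul, coeff_X_pow_mul]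
  have hcast : ∀ j ≤ 9, ∀ r : ℕ,
      Nat.descFactorial 9 (9 - j) * ((56 - j).descFactorial (9 - j) / (9 - j).factorial) % 19 = r →
      (((gInt 9 47).coeff j : ℤ) : ZMod 19) = r := by
    rintro j hj r rfl
    rw [← Nat.choose_eq_descFactorial_div_factorial, Nat.choose_symm_of_eq_add (b := 47) (by omega),
      gInt_coeff, if_pos hj, ZMod.natCast_mod, Int.cast_natCast, gCoeff]
  have key : ∀ x y : ZMod 19,
      let h₇ : ZMod 19 := 1
      let h₆ := 14 - x * h₇
      let h₅ := 8 - x * h₆ - y * h₇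
      let h₄ := 15 - x * h₅ - y * h₆
      let h₃ := 17 - x * h₄ - y * h₅
      let h₂ := 10 - x * h₃ - y * h₄
      let h₁ := 5 - x * h₂ - y * h₃
      let h₀ := 18 - x * h₁ - y * h₂
      x * h₀ + y * h₁ = 10 → y * h₀ ≠ 1 := by decide +kernel
  have e0 := congrArg (Int.cast : ℤ → ZMod 19) h0
  have e1 := congrArg (Int.cast : ℤ → ZMod 19) h1
  have e : ∀ j ≤ 7, ∀ r : ℕ, Nat.descFactorial 9 (9 - (j + 2)) *
      ((56 - (j + 2)).descFactorial (9 - (j + 2)) / (9 - (j + 2)).factorial) % 19 = r → ((g.coeff j : ℤ) : ZMod 19) =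
      r - b * (g.coeff (j + 1) : ℤ) - c * (g.coeff (j + 2) : ℤ) := by
    intro j hj r hr
    have := congrArg (Int.cast : ℤ → ZMod 19) (h2 j)
    rw [hcast (j + 2) (by omega) r hr] at this
    rw [← this]
    push_cast
    ring
  rw [hcast 0 (by omega) 1 (by decide)] at e0
  rw [hcast 1 (by omega) 10 (by decide)] at e1
  have f0 := e 0 (by omega) 18 (by decide)
  have f1 := e 1 (by omega) 5 (by decide)
  have f2 := e 2 (by omega) 10 (by decide)
  have f3 := e 3 (by omega) 17 (by decide)
  have f4 := e 4 (by omega) 15 (by decide)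
  have f5 := e 5 (by omega) 8 (by decide)
  have f6 := e 6 (by omega) 14 (by decide)
  have f7 := e 7 (by omega) 1 (by decide)
  rw [hz 8 (by omega), hz 9 (by omega)] at f7
  rw [hz 8 (by omega)] at f6
  push_cast at e0 e1 f0 f1 f2 f3 f4 f5 f6 f7
  simp only [mul_zero, sub_zero] at f6 f7
  generalize ((g.coeff 7 : ℤ) : ZMod 19) = h₇ at *
  generalize ((g.coeff 6 : ℤ) : ZMod 19) = h₆ at *
  generalize ((g.coeff 5 : ℤ) : ZMod 19) = h₅ at *
  generalize ((g.coeff 4 : ℤ) : ZMod 19) = h₄ at *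
  generalize ((g.coeff 3 : ℤ) : ZMod 19) = h₃ at *
  generalize ((g.coeff 2 : ℤ) : ZMod 19) = h₂ at *
  generalize ((g.coeff 1 : ℤ) : ZMod 19) = h₁ at *
  generalize ((g.coeff 0 : ℤ) : ZMod 19) = h₀ at *
  subst f7 f6 f5 f4 f3 f2 f1 f0
  exact key b c e1 e0

theorem not_hasFactor_of_exceptional (h : exceptional n s k = true) : ¬ HasFactor n s k := by
  rw [exceptional, anyB_eq_true] at h
  obtain ⟨x, hx, h⟩ := h
  rw [andB_eq_true, andB_eq_true] at h
  obtain rfl : k = x.1 := Nat.eq_of_beq_eq_true h.1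
  obtain rfl : n = x.2.1 := Nat.eq_of_beq_eq_true h.2.1
  obtain rfl : s = x.2.2 := Nat.eq_of_beq_eq_true h.2.2
  simp only [exceptions, List.mem_cons, List.not_mem_nil, or_false] at hx
  rcases hx with rfl | rfl | rfl | rfl | rfl | rfl | rfl | rfl | rfl | rfl | rfl | rfl | rfl | rfl | rfl | rfl | rfl | rfl | rfl | rfl | rfl | rfl | rfl | rfl | rfl | rfl | rfl
  · exact not_hasFactor_of_slopesBetween 2 501 300 0 5 3 3 (by decide +kernel)
  · exact not_hasFactor_one_of_eval_ne_zero 5 (by decide +kernel)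
  · exact not_hasFactor_one_of_eval_ne_zero 13 (by decide +kernel)
  · exact not_hasFactor_of_slopesBetween 3 401 300 0 4 3 3 (by decide +kernel)
  · exact not_hasFactor_of_slopesBetween 7 101 700 1 1 7 8 (by decide +kernel)
  · exact not_hasFactor_of_slopesBetween 2 601 500 0 6 5 5 (by decide +kernel)
  · exact not_hasFactor_of_slopesBetween 2 701 800 1 7 8 9 (by decide +kernel)
  · exact not_hasFactor_of_slopesBetween 5 301 1000 1 1 5 16 (by decide +kernel)
  · exact not_hasFactor_of_slopesBetween 3 101 300 1 1 3 4 (by decide +kernel)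
  · exact not_hasFactor_of_slopesBetween 3 801 1500 0 8 15 15 (by decide +kernel)
  · exact not_hasFactor_of_slopesBetween 3 501 900 0 5 9 9 (by decide +kernel)
  · exact not_hasFactor_of_slopesBetween 2 1501 1600 0 15 16 16 (by decide +kernel)
  · exact not_hasFactor_of_slopesBetween 11 101 1100 1 1 11 12 (by decide +kernel)
  · exact not_hasFactor_two_9_47
  · exact not_hasFactor_of_slopesBetween 2 501 400 0 5 4 4 (by decide +kernel)
  · exact not_hasFactor_of_slopesBetween 2 701 800 0 7 8 8 (by decide +kernel)
  · exact not_hasFactor_of_slopesBetween 2 501 400 0 5 4 8 (by decide +kernel)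
  · exact not_hasFactor_of_slopesBetween 2 701 600 0 7 6 6 (by decide +kernel)
  · exact not_hasFactor_of_slopesBetween 2 1501 1600 0 15 16 16 (by decide +kernel)
  · exact not_hasFactor_of_slopesBetween 3 401 900 0 4 9 9 (by decide +kernel)
  · exact not_hasFactor_of_slopesBetween 7 101 700 1 1 7 8 (by decide +kernel)
  · exact not_hasFactor_of_slopesBetween 5 301 1000 1 1 5 16 (by decide +kernel)
  · exact not_hasFactor_of_slopesBetween 2 1501 1600 0 15 16 16 (by decide +kernel)
  · exact not_hasFactor_of_slopesBetween 7 201 700 1 2 7 8 (by decide +kernel)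
  · exact not_hasFactor_of_slopesBetween 2 701 600 0 7 6 6 (by decide +kernel)
  · exact not_hasFactor_of_slopesBetween 2 1701 1600 0 17 16 16 (by decide +kernel)
  · exact not_hasFactor_of_slopesBetween 2 1701 1600 0 17 16 16 (by decide +kernel)

end Exceptions

section Final

theorem eq_true_of_allB_range {f : ℕ → Bool} {a m : ℕ}
    (h : allB (fun j => f (j + a)) (List.range m) = true) {n : ℕ} (ha : a ≤ n) (hn : n < m + a) :
    f n = true := by
  obtain ⟨j, rfl⟩ := Nat.exists_eq_add_of_le' ha
  exact allB_eq_true.mp h j (List.mem_range.mpr (by omega))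

theorem smallTest_one_of_ge_9 : allB (fun j => smallTest 1 (j + 9)) (List.range 53) = true := by
  decide +kernel

theorem smallTest_one_of_ge_62 : allB (fun j => smallTest 1 (j + 62)) (List.range 7) = true := by
  decide +kernel

theorem smallTest_one_of_ge_69 : allB (fun j => smallTest 1 (j + 69)) (List.range 9) = true := by
  decide +kernel

theorem smallTest_one_of_ge_78 : allB (fun j => smallTest 1 (j + 78)) (List.range 8) = true := by
  decide +kernel

theorem smallTest_one_of_ge_86 : allB (fun j => smallTest 1 (j + 86)) (List.range 3) = true := by
  decide +kernel

theorem smallTest_one {s : ℕ} (hs : 9 ≤ s) (hs' : s ≤ 88) : smallTest 1 s = true := by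
  rcases Nat.lt_or_ge s 62 with h | h
  · exact eq_true_of_allB_range smallTest_one_of_ge_9 (by omega) h
  rcases Nat.lt_or_ge s 69 with h | h
  · exact eq_true_of_allB_range smallTest_one_of_ge_62 (by omega) h
  rcases Nat.lt_or_ge s 78 with h | h
  · exact eq_true_of_allB_range smallTest_one_of_ge_69 (by omega) h
  rcases Nat.lt_or_ge s 86 with h | h
  · exact eq_true_of_allB_range smallTest_one_of_ge_78 (by omega) h
  exact eq_true_of_allB_range smallTest_one_of_ge_86 h (by omega)

theorem smallTest_two_of_ge_9 : allB (fun j => smallTest 2 (j + 9)) (List.range 54) = true := by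
  decide +kernel

theorem smallTest_two_of_ge_63 : allB (fun j => smallTest 2 (j + 63)) (List.range 11) = true := by
  decide +kernel

theorem smallTest_two_of_ge_74 : allB (fun j => smallTest 2 (j + 74)) (List.range 11) = true := by
  decide +kernel

theorem smallTest_two_of_ge_85 : allB (fun j => smallTest 2 (j + 85)) (List.range 4) = true := by
  decide +kernel

theorem smallTest_two {s : ℕ} (hs : 9 ≤ s) (hs' : s ≤ 88) : smallTest 2 s = true := by
  rcases Nat.lt_or_ge s 63 with h | h
  · exact eq_true_of_allB_range smallTest_two_of_ge_9 (by omega) h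
  rcases Nat.lt_or_ge s 74 with h | h
  · exact eq_true_of_allB_range smallTest_two_of_ge_63 (by omega) h
  rcases Nat.lt_or_ge s 85 with h | h
  · exact eq_true_of_allB_range smallTest_two_of_ge_74 (by omega) h
  exact eq_true_of_allB_range smallTest_two_of_ge_85 h (by omega)

theorem smallTest_three : allB (fun j => smallTest 3 (j + 9)) (List.range 80) = true := by
  decide +kernel

theorem smallTest_ge_four : allB (fun i => allB (fun j => smallTest (i + 4) (j + 9))
    (List.range 80)) (List.range 4) = true := by
  decide +kernel

theorem largeTest_of_ge_8 : allB (fun j => largeTest (j + 8)) (List.range 1) = true := by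
  decide +kernel

theorem largeTest_of_ge_9 : allB (fun j => largeTest (j + 9)) (List.range 3) = true := by
  decide +kernel

theorem largeTest_of_ge_12 : allB (fun j => largeTest (j + 12)) (List.range 16) = true := by
  decide +kernel

theorem largeTest_of_ge_28 : allB (fun j => largeTest (j + 28)) (List.range 60) = true := by
  decide +kernel

theorem largeTest_eq_true {k : ℕ} (hk : 8 ≤ k) (hk' : k ≤ 87) : largeTest k = true := by
  rcases Nat.lt_or_ge k 9 with h | h
  · exact eq_true_of_allB_range largeTest_of_ge_8 (by omega) h
  rcases Nat.lt_or_ge k 12 with h | h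
  · exact eq_true_of_allB_range largeTest_of_ge_9 (by omega) h
  rcases Nat.lt_or_ge k 28 with h | h
  · exact eq_true_of_allB_range largeTest_of_ge_12 (by omega) h
  exact eq_true_of_allB_range largeTest_of_ge_28 h (by omega)

theorem smallTest_eq_true {k s : ℕ} (hk : 1 ≤ k) (hk7 : k ≤ 7) (hs : 9 ≤ s) (hs' : s ≤ 88) :
    smallTest k s = true := by
  obtain rfl | rfl | rfl | hk4 : k = 1 ∨ k = 2 ∨ k = 3 ∨ 4 ≤ k := by omega
  · exact smallTest_one hs hs'
  · exact smallTest_two hs hs'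
  · exact eq_true_of_allB_range smallTest_three hs (by omega)
  · exact eq_true_of_allB_range (f := smallTest k) (eq_true_of_allB_range
      (f := fun k => allB (fun j => smallTest k (j + 9)) (List.range 80)) smallTest_ge_four hk4
      (by omega)) hs (by omega)

theorem not_hasFactor {n s k : ℕ} (hs : 9 ≤ s) (hs' : s ≤ 88) (hk : 1 ≤ k) (h2 : 2 * k ≤ n) :
    ¬ HasFactor n s k := by
  rcases le_or_gt s k with hsk | hks
  · exact not_hasFactor_of_le (by omega) hsk h2
  rcases Nat.lt_or_ge k 8 with hk8 | hk8
  · cases hex : exceptional n s k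
    · exact not_hasFactor_of_smallTest hk (by omega) hks.le hs' h2 hex
        (smallTest_eq_true hk (by omega) hs hs')
    · exact not_hasFactor_of_exceptional hex
  · exact not_hasFactor_of_largeTest hk8 hks hs' h2 (largeTest_eq_true hk8 (by omega))

end Final

theorem g1_irreducible_of_nine_le_s_le_88 (n s : ℕ) (hn : 1 ≤ n)
    (hs9 : 9 ≤ s) (hs88 : s ≤ 88) : Irreducible (g1 n s) := by
  exact irreducible_of_not_hasFactor hn fun k hk h2 => not_hasFactor hs9 hs88 hk h2
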